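/- arXiv:2312.05825 — 6 statements merged into one kernel-verified Lean document; each statement's English description precedes it below -/
import Mathlib

section
/- Existence and uniqueness for the gradient-flow Cauchy problem with datum in D(∂I): let H be a real Hilbert space and I : H → ℝ ∪ {+∞} proper, convex and lower semicontinuous. For each u₀ ∈ D(∂I) there exists a unique Lipschitz continuous function u : [0,∞) → H such that u(0) = u₀, u(t) ∈ D(∂I) for all t ≥ 0, u is differentiable at a.e. t > 0, and −u'(t) ∈ ∂I(u(t)) for a.e. t > 0. Moreover this solution satisfies ‖u(t) − u(s)‖ ≤ ‖A⁰(u₀)‖ · |t − s| for all t, s ≥ 0, where A⁰(u₀) is the minimal-norm element of ∂I(u₀). -/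
open MeasureTheory Filter Topology Set
open scoped RealInnerProductSpace

/-- The subdifferential of an `EReal`-valued functional `I` on a real inner product
space `H` at a point `u`:
`∂I(u) = {v ∈ H : I(w) ≥ I(u) + ⟨v, w − u⟩ for all w ∈ H}`. -/
def subdiff {H : Type*} [NormedAddCommGroup H] [InnerProductSpace ℝ H]
    (I : H → EReal) (u : H) : Set H :=
  {v | ∀ w : H, I u + ((⟪v, w - u⟫ : ℝ) : EReal) ≤ I w}

/-- Convexity of an `EReal`-valued functional. -/
def ERealConvex {H : Type*} [NormedAddCommGroup H] [InnerProductSpace ℝ H]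
    (I : H → EReal) : Prop :=
  ∀ u v : H, ∀ a b : ℝ, 0 ≤ a → 0 ≤ b → a + b = 1 →
    I (a • u + b • v) ≤ (a : EReal) * I u + (b : EReal) * I v

section MonotoneOperators

variable {H : Type*} [NormedAddCommGroup H] [InnerProductSpace ℝ H]

/-- A monotone set-valued operator satisfying Minty's range condition `R(1 + l A) = H`
for all `l > 0`. -/
structure IsMaximalMonotone (A : H → Set H) : Prop where
  monotone : ∀ {x y p q : H}, p ∈ A x → q ∈ A y → 0 ≤ ⟪p - q, x - y⟫
  range : ∀ {l : ℝ}, 0 < l → ∀ x : H, ∃ y, ∃ p ∈ A y, y + l • p = x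

/-- The resolvent `(1 + l A)⁻¹` of a set-valued operator. -/
noncomputable def monotoneResolvent (A : H → Set H) (l : ℝ) (x : H) : H :=
  Classical.epsilon fun y => ∃ p ∈ A y, y + l • p = x

/-- The minimal section `A⁰` of a set-valued operator. -/
noncomputable def minSection (A : H → Set H) (x : H) : H :=
  Classical.epsilon fun p => p ∈ A x ∧ ∀ q ∈ A x, ‖p‖ ≤ ‖q‖

/-- The step size `1 / (k + 1)` of the `k`-th Euler scheme. -/
noncomputable def eulerStep (k : ℕ) : ℝ := ((k : ℝ) + 1)⁻¹

/-- The limit of the implicit Euler scheme for `u' ∈ -A u`, `u 0 = x`, at time `t`. -/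
noncomputable def monotoneFlow (A : H → Set H) (t : ℝ) (x : H) : H :=
  @limUnder _ _ _ ⟨x⟩ atTop
    fun k : ℕ => (monotoneResolvent A (eulerStep k))^[⌊t * ((k : ℝ) + 1)⌋₊] x

/-- A bounded family in a Hilbert space converges weakly along every ultrafilter. -/
theorem exists_tendsto_inner_of_norm_le [CompleteSpace H] {ι : Type*} (U : Ultrafilter ι)
    {p : ι → H} {C : ℝ} (hp : ∀ᶠ i in U, ‖p i‖ ≤ C) :
    ∃ b : H, ∀ w : H, Tendsto (fun i => ⟪p i, w⟫) U (𝓝 ⟪b, w⟫) := by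
  let φ : ι → WeakDual ℝ H := fun i =>
    StrongDual.toWeakDual (InnerProductSpace.toDual ℝ H (p i))
  have hK := WeakDual.isCompact_closedBall (𝕜 := ℝ) (0 : StrongDual ℝ H) C
  obtain ⟨ℓ, -, hℓ⟩ := isCompact_iff_ultrafilter_le_nhds'.1 hK (U.map φ) (by
    rw [Ultrafilter.mem_map]
    filter_upwards [hp] with i hi
    change InnerProductSpace.toDual ℝ H (p i) ∈ Metric.closedBall 0 C
    simpa using hi)
  refine ⟨(InnerProductSpace.toDual ℝ H).symm (WeakDual.toStrongDual ℓ), fun w => ?_⟩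
  have h : Tendsto φ U (𝓝 ℓ) := hℓ
  have h2 := ((WeakDual.eval_continuous w).tendsto ℓ).comp h
  rw [InnerProductSpace.toDual_symm_apply]
  exact h2

theorem eulerStep_pos (k : ℕ) : 0 < eulerStep k := by
  unfold eulerStep; positivity

theorem tendsto_eulerStep : Tendsto (fun k => eulerStep k) atTop (𝓝 0) := by
  simpa only [eulerStep, one_div] using tendsto_one_div_add_atTop_nhds_zero_nat (𝕜 := ℝ)

theorem tendsto_floor_mul_eulerStep {t : ℝ} (ht : 0 ≤ t) :
    Tendsto (fun k : ℕ => (⌊t * ((k : ℝ) + 1)⌋₊ : ℝ) * eulerStep k) atTop (𝓝 t) := by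
  have h : Tendsto (fun k : ℕ => (k : ℝ) + 1) atTop atTop :=
    tendsto_atTop_add_const_right _ _ tendsto_natCast_atTop_atTop
  exact (tendsto_nat_floor_mul_div_atTop ht).comp h

namespace IsMaximalMonotone

variable {A : H → Set H} (hA : IsMaximalMonotone A)

include hA

theorem mem_of_forall_inner_nonneg {x p : H} (h : ∀ w, ∀ q ∈ A w, 0 ≤ ⟪p - q, x - w⟫) :
    p ∈ A x := by
  obtain ⟨y, q, hq, hy⟩ := hA.range one_pos (x + p)
  have h1 := h y q hq
  have h2 : p - q = -(x - y) := by
    rw [one_smul] at hy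
    linear_combination (norm := module) -hy
  rw [h2, inner_neg_left, real_inner_self_eq_norm_sq] at h1
  have h3 : x - y = 0 := by
    rw [← norm_eq_zero]; nlinarith [norm_nonneg (x - y)]
  have h4 : x = y := sub_eq_zero.1 h3
  have h5 : p = q := by rw [h3, neg_zero] at h2; exact sub_eq_zero.1 h2
  rwa [h4, h5]

section Weak

variable [CompleteSpace H]

theorem exists_mem_norm_le {ι : Type*} (U : Ultrafilter ι) {p : ι → H} {c : ι → ℝ} {m : ℝ}
    {x : H} (hp : ∀ᶠ i in U, ‖p i‖ ≤ c i) (hc : Tendsto c U (𝓝 m))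
    (hmono : ∀ w, ∀ q ∈ A w, ∃ e : ι → ℝ, Tendsto e U (𝓝 0) ∧
      ∀ᶠ i in U, -e i ≤ ⟪p i - q, x - w⟫) :
    ∃ b ∈ A x, ‖b‖ ≤ m ∧ ∀ w : H, Tendsto (fun i => ⟪p i, w⟫) U (𝓝 ⟪b, w⟫) := by
  obtain ⟨b, hb⟩ := exists_tendsto_inner_of_norm_le U (p := p) (C := m + 1) (by
    filter_upwards [hp, hc.eventually (gt_mem_nhds (lt_add_one m))] with i h1 h2
    linarith)
  refine ⟨b, hA.mem_of_forall_inner_nonneg fun w q hq => ?_, ?_, hb⟩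
  · obtain ⟨e, he, h⟩ := hmono w q hq
    have h1 : Tendsto (fun i => ⟪p i - q, x - w⟫) U (𝓝 ⟪b - q, x - w⟫) := by
      simp_rw [inner_sub_left _ q]
      exact (hb _).sub tendsto_const_nhds
    simpa using le_of_tendsto_of_tendsto he.neg h1 h
  · have hm : 0 ≤ m := ge_of_tendsto hc (hp.mono fun i hi => (norm_nonneg _).trans hi)
    have h1 : ⟪b, b⟫ ≤ m * ‖b‖ := by
      refine le_of_tendsto_of_tendsto (hb b) (hc.mul_const ‖b‖) ?_
      filter_upwards [hp] with i hi
      exact (real_inner_le_norm _ _).trans (by gcongr)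
    rw [real_inner_self_eq_norm_sq] at h1
    by_contra! hlt
    nlinarith [norm_nonneg b]

theorem exists_mem_norm_le_of_tendsto {ι : Type*} {F : Filter ι} [F.NeBot] {x : ι → H} {x₀ : H}
    {M : ℝ} (hx : Tendsto x F (𝓝 x₀)) (hp : ∀ i, ∃ p ∈ A (x i), ‖p‖ ≤ M) :
    ∃ p ∈ A x₀, ‖p‖ ≤ M := by
  choose p hpA hpM using hp
  have hU : (Ultrafilter.of F : Filter ι) ≤ F := Ultrafilter.of_le F
  obtain ⟨b, hb, hbM, -⟩ := hA.exists_mem_norm_le (Ultrafilter.of F) (p := p) (c := fun _ => M)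
    (x := x₀) (.of_forall hpM) tendsto_const_nhds (fun w q hq => by
      refine ⟨fun i => (M + ‖q‖) * ‖x i - x₀‖, ?_, .of_forall fun i => ?_⟩
      · have := ((hx.mono_left hU).sub_const x₀).norm.const_mul (M + ‖q‖)
        simpa using this
      · have h1 := hA.monotone (hpA i) hq
        have h2 : ⟪p i - q, x₀ - w⟫ = ⟪p i - q, x i - w⟫ - ⟪p i - q, x i - x₀⟫ := by
          rw [← inner_sub_right]; congr 1; abel
        have h3 := real_inner_le_norm (p i - q) (x i - x₀)
        have h4 : ‖p i - q‖ ≤ M + ‖q‖ := (norm_sub_le _ _).trans (by gcongr; exact hpM i)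
        have h5 := mul_le_mul_of_nonneg_right h4 (norm_nonneg (x i - x₀))
        linarith)
  exact ⟨b, hb, hbM⟩

theorem minSection_spec {x : H} (hx : (A x).Nonempty) :
    minSection A x ∈ A x ∧ ∀ q ∈ A x, ‖minSection A x‖ ≤ ‖q‖ := by
  refine Classical.epsilon_spec (p := fun p => p ∈ A x ∧ ∀ q ∈ A x, ‖p‖ ≤ ‖q‖) ?_
  have hbdd : BddBelow (norm '' A x) := ⟨0, by rintro _ ⟨q, -, rfl⟩; exact norm_nonneg q⟩
  have hp : ∀ n : ℕ, ∃ p ∈ A x, ‖p‖ ≤ sInf (norm '' A x) + 1 / ((n : ℝ) + 1) := fun n => by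
    obtain ⟨_, ⟨p, hp, rfl⟩, h⟩ := exists_lt_of_csInf_lt (hx.image norm)
      (lt_add_of_pos_right (sInf (norm '' A x)) (Nat.one_div_pos_of_nat (α := ℝ) (n := n)))
    exact ⟨p, hp, h.le⟩
  choose p hpA hpm using hp
  have hlim : Tendsto (fun n : ℕ => sInf (norm '' A x) + 1 / ((n : ℝ) + 1)) atTop
      (𝓝 (sInf (norm '' A x))) := by
    simpa using Tendsto.const_add (sInf (norm '' A x))
      (tendsto_one_div_add_atTop_nhds_zero_nat (𝕜 := ℝ))
  obtain ⟨b, hb, hbm, -⟩ := hA.exists_mem_norm_le (Ultrafilter.of atTop) (p := p)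
    (m := sInf (norm '' A x)) (x := x) (.of_forall hpm)
    (hlim.mono_left (Ultrafilter.of_le _))
    (fun w q hq => ⟨fun _ => 0, tendsto_const_nhds, .of_forall fun i => by
      simpa using hA.monotone (hpA i) hq⟩)
  exact ⟨b, hb, fun q hq => hbm.trans (csInf_le hbdd ⟨q, hq, rfl⟩)⟩

theorem eq_minSection {x b : H} (hb : b ∈ A x) (h : ‖b‖ ≤ ‖minSection A x‖) :
    b = minSection A x := by
  obtain ⟨ha, hmin⟩ := hA.minSection_spec ⟨b, hb⟩
  set a := minSection A x
  have hmid : (2⁻¹ : ℝ) • (a + b) ∈ A x := hA.mem_of_forall_inner_nonneg fun w q hq => by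
    have h1 := hA.monotone ha hq
    have h2 := hA.monotone hb hq
    have h3 : (2⁻¹ : ℝ) • (a + b) - q = (2⁻¹ : ℝ) • ((a - q) + (b - q)) := by module
    rw [h3, real_inner_smul_left, inner_add_left]
    positivity
  have h1 := hmin _ hmid
  rw [norm_smul, Real.norm_of_nonneg (by norm_num)] at h1
  have h2 := parallelogram_law_with_norm ℝ a b
  have h3 : ‖a - b‖ = 0 := by
    nlinarith [norm_nonneg (a - b), norm_nonneg a, norm_nonneg b]
  exact (sub_eq_zero.1 (norm_eq_zero.1 h3)).symm

theorem tendsto_minSection {ι : Type*} {F : Filter ι} {p : ι → H} {c : ι → ℝ} {x : H}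
    (hp : ∀ᶠ i in F, ‖p i‖ ≤ c i) (hc : Tendsto c F (𝓝 ‖minSection A x‖))
    (hmono : ∀ w, ∀ q ∈ A w, ∃ e : ι → ℝ, Tendsto e F (𝓝 0) ∧
      ∀ᶠ i in F, -e i ≤ ⟪p i - q, x - w⟫) :
    Tendsto p F (𝓝 (minSection A x)) := by
  rw [tendsto_iff_ultrafilter]
  intro U hU
  obtain ⟨b, hb, hbm, hw⟩ := hA.exists_mem_norm_le U (hU hp) (hc.mono_left hU)
    (fun w q hq => (hmono w q hq).imp fun e he => ⟨he.1.mono_left hU, hU he.2⟩)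
  have hba := hA.eq_minSection hb hbm
  rw [hba] at hw
  set a := minSection A x
  rw [tendsto_iff_norm_sub_tendsto_zero]
  have hsq : Tendsto (fun i => ‖p i - a‖ ^ 2) U (𝓝 0) := by
    have h1 : Tendsto (fun i => c i ^ 2 - 2 * ⟪p i, a⟫ + ‖a‖ ^ 2) U (𝓝 0) := by
      have := (((hc.mono_left hU).pow 2).sub ((hw a).const_mul 2)).add_const (‖a‖ ^ 2)
      rw [real_inner_self_eq_norm_sq] at this
      convert this using 2
      ring
    refine squeeze_zero' (.of_forall fun i => sq_nonneg _) ?_ h1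
    filter_upwards [hU hp] with i hi
    rw [norm_sub_sq_real]
    gcongr
  have := hsq.sqrt
  simpa using this

end Weak

theorem resolvent_spec {l : ℝ} (hl : 0 < l) (x : H) :
    ∃ p ∈ A (monotoneResolvent A l x), monotoneResolvent A l x + l • p = x :=
  Classical.epsilon_spec (hA.range hl x)

theorem norm_sub_le_of_add_smul {l : ℝ} (hl : 0 < l) {x y p q : H} (hp : p ∈ A x) (hq : q ∈ A y) :
    ‖x - y‖ ≤ ‖(x + l • p) - (y + l • q)‖ := by
  have h1 := hA.monotone hp hq
  have h2 : (x + l • p) - (y + l • q) = (x - y) + l • (p - q) := by module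
  have h3 : ‖x - y‖ ^ 2 ≤ ‖x - y‖ * ‖(x + l • p) - (y + l • q)‖ := by
    refine le_trans ?_ (real_inner_le_norm _ _)
    rw [h2, inner_add_right, real_inner_self_eq_norm_sq, real_inner_smul_right, real_inner_comm]
    nlinarith
  by_contra! hlt
  nlinarith [norm_nonneg ((x + l • p) - (y + l • q))]

theorem norm_resolvent_sub_le {l : ℝ} (hl : 0 < l) (x y : H) :
    ‖monotoneResolvent A l x - monotoneResolvent A l y‖ ≤ ‖x - y‖ := by
  obtain ⟨p, hp, hx⟩ := hA.resolvent_spec hl x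
  obtain ⟨q, hq, hy⟩ := hA.resolvent_spec hl y
  simpa only [hx, hy] using hA.norm_sub_le_of_add_smul hl hp hq

theorem norm_iterate_resolvent_sub_le {l : ℝ} (hl : 0 < l) (n : ℕ) (x y : H) :
    ‖(monotoneResolvent A l)^[n] x - (monotoneResolvent A l)^[n] y‖ ≤ ‖x - y‖ := by
  induction n with
  | zero => simp
  | succ n ih =>
    rw [Function.iterate_succ_apply', Function.iterate_succ_apply']
    exact (hA.norm_resolvent_sub_le hl _ _).trans ih

theorem exists_mem_resolvent_norm_le {l : ℝ} (hl : 0 < l) {x p : H} (hp : p ∈ A x) :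
    ∃ q ∈ A (monotoneResolvent A l x), monotoneResolvent A l x + l • q = x ∧ ‖q‖ ≤ ‖p‖ := by
  obtain ⟨q, hq, hx⟩ := hA.resolvent_spec hl x
  refine ⟨q, hq, hx, ?_⟩
  have h1 := hA.monotone hp hq
  have h2 : x - monotoneResolvent A l x = l • q := by
    linear_combination (norm := module) -hx
  rw [h2, real_inner_smul_right, inner_sub_left, real_inner_self_eq_norm_sq] at h1
  have h3 := nonneg_of_mul_nonneg_right h1 hl
  have h4 := real_inner_le_norm p q
  by_contra! hlt
  nlinarith [norm_nonneg p]

theorem exists_mem_iterate_resolvent_norm_le {l : ℝ} (hl : 0 < l) {x p : H} (hp : p ∈ A x)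
    (n : ℕ) : ∃ q ∈ A ((monotoneResolvent A l)^[n] x), ‖q‖ ≤ ‖p‖ := by
  induction n with
  | zero => exact ⟨p, hp, le_rfl⟩
  | succ n ih =>
    obtain ⟨q, hq, hqp⟩ := ih
    obtain ⟨r, hr, -, hrq⟩ := hA.exists_mem_resolvent_norm_le hl hq
    rw [Function.iterate_succ_apply']
    exact ⟨r, hr, hrq.trans hqp⟩

theorem norm_iterate_add_sub_le {l : ℝ} (hl : 0 < l) {x p : H} (hp : p ∈ A x) (n m : ℕ) :
    ‖(monotoneResolvent A l)^[n + m] x - (monotoneResolvent A l)^[n] x‖ ≤ m * l * ‖p‖ := by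
  induction m with
  | zero => simp
  | succ m ih =>
    obtain ⟨q, hq, hqp⟩ := hA.exists_mem_iterate_resolvent_norm_le hl hp (n + m)
    obtain ⟨r, -, hr, hrq⟩ := hA.exists_mem_resolvent_norm_le hl hq
    rw [← add_assoc, Function.iterate_succ_apply']
    set z := (monotoneResolvent A l)^[n + m] x
    have h1 : monotoneResolvent A l z - z = -(l • r) := by
      linear_combination (norm := module) hr
    have h2 : ‖monotoneResolvent A l z - z‖ ≤ l * ‖p‖ := by
      rw [h1, norm_neg, norm_smul, Real.norm_of_nonneg hl.le]
      gcongr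
      exact hrq.trans hqp
    have h3 := norm_sub_le_norm_sub_add_norm_sub (monotoneResolvent A l z) z
      ((monotoneResolvent A l)^[n] x)
    push_cast
    linarith

theorem norm_iterate_sub_iterate_le {l : ℝ} (hl : 0 < l) {x p : H} (hp : p ∈ A x) (n m : ℕ) :
    ‖(monotoneResolvent A l)^[n] x - (monotoneResolvent A l)^[m] x‖ ≤ |n * l - m * l| * ‖p‖ := by
  wlog h : m ≤ n generalizing n m
  · rw [norm_sub_rev, abs_sub_comm]
    exact this m n (le_of_not_ge h)
  obtain ⟨k, rfl⟩ := Nat.exists_eq_add_of_le h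
  refine (hA.norm_iterate_add_sub_le hl hp m k).trans_eq ?_
  push_cast
  rw [show ((m : ℝ) + k) * l - m * l = k * l by ring, abs_of_nonneg (by positivity)]

theorem norm_iterate_sub_le {l : ℝ} (hl : 0 < l) {x p : H} (hp : p ∈ A x) (n : ℕ) :
    ‖(monotoneResolvent A l)^[n] x - x‖ ≤ n * l * ‖p‖ := by
  simpa using hA.norm_iterate_add_sub_le hl hp 0 n

theorem norm_resolvent_sub_resolvent_sq_le {l μ : ℝ} (hμ : 0 < μ) (hl : μ ≤ l) (x z : H) :
    ‖monotoneResolvent A l x - monotoneResolvent A μ z‖ ^ 2 ≤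
      μ / l * ‖x - z‖ ^ 2 + (1 - μ / l) * ‖monotoneResolvent A l x - z‖ ^ 2 := by
  have hl0 : 0 < l := hμ.trans_le hl
  obtain ⟨p, hp, hx⟩ := hA.resolvent_spec hl0 x
  obtain ⟨q, hq, hz⟩ := hA.resolvent_spec hμ z
  have h1 := hA.norm_sub_le_of_add_smul hμ hp hq
  set a := monotoneResolvent A l x
  set b := monotoneResolvent A μ z
  set α := μ / l with hα
  have hαl : α * l = μ := div_mul_cancel₀ _ hl0.ne'
  have hα0 : 0 ≤ α := by positivity
  have hα1 : 0 ≤ 1 - α := by rw [sub_nonneg, div_le_one hl0]; exact hl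
  have h2 : a + μ • p - (b + μ • q) = α • (x - z) + (1 - α) • (a - z) := by
    rw [hz, ← hx, ← hαl]; module
  rw [h2] at h1
  have h3 : ‖a - b‖ ≤ α * ‖x - z‖ + (1 - α) * ‖a - z‖ := by
    refine h1.trans ((norm_add_le _ _).trans_eq ?_)
    rw [norm_smul, norm_smul, Real.norm_of_nonneg hα0, Real.norm_of_nonneg hα1]
  calc ‖a - b‖ ^ 2 ≤ (α * ‖x - z‖ + (1 - α) * ‖a - z‖) ^ 2 := by gcongr
    _ ≤ _ := by nlinarith [mul_nonneg (mul_nonneg hα0 hα1) (sq_nonneg (‖x - z‖ - ‖a - z‖))]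

/-- The Crandall–Liggett estimate comparing Euler schemes of different step sizes. -/
theorem norm_iterate_sub_iterate_sq_le_of_le {l μ : ℝ} (hμ : 0 < μ) (hl : μ ≤ l) {x p : H}
    (hp : p ∈ A x) (n m : ℕ) :
    ‖(monotoneResolvent A l)^[n] x - (monotoneResolvent A μ)^[m] x‖ ^ 2 ≤
      ‖p‖ ^ 2 * ((n * l - m * μ) ^ 2 + n * l * l + m * μ * μ) := by
  have hl0 : 0 < l := hμ.trans_le hl
  induction m generalizing n with
  | zero =>
    have h1 := hA.norm_iterate_sub_le hl0 hp n
    calc _ ≤ (n * l * ‖p‖) ^ 2 := by gcongr; simpa using h1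
      _ ≤ _ := by
        have : 0 ≤ ‖p‖ ^ 2 * (n * l * l) := by positivity
        push_cast
        nlinarith
  | succ m ih =>
    cases n with
    | zero =>
      have h1 := hA.norm_iterate_sub_le hμ hp (m + 1)
      calc _ ≤ ((m + 1 : ℕ) * μ * ‖p‖) ^ 2 := by
            gcongr; rw [norm_sub_rev]; simpa using h1
        _ ≤ _ := by
          have : 0 ≤ ‖p‖ ^ 2 * ((m + 1) * μ * μ) := by positivity
          push_cast
          nlinarith
    | succ n =>
      have h1 := ih n
      have h2 := ih (n + 1)
      rw [Function.iterate_succ_apply' _ n] at h2 ⊢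
      rw [Function.iterate_succ_apply' _ m]
      have h3 := hA.norm_resolvent_sub_resolvent_sq_le hμ hl ((monotoneResolvent A l)^[n] x)
        ((monotoneResolvent A μ)^[m] x)
      set α := μ / l with hα
      have hαl : α * l = μ := div_mul_cancel₀ _ hl0.ne'
      have hα0 : 0 ≤ α := by positivity
      have hα1 : 0 ≤ 1 - α := by rw [sub_nonneg, div_le_one hl0]; exact hl
      refine h3.trans ((add_le_add (mul_le_mul_of_nonneg_left h1 hα0)
        (mul_le_mul_of_nonneg_left h2 hα1)).trans ?_)
      have h4 : 0 ≤ ‖p‖ ^ 2 * (2 * (α * l) ^ 2) := by positivity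
      push_cast
      rw [← hαl]
      nlinarith

theorem norm_iterate_sub_iterate_sq_le {l μ : ℝ} (hl : 0 < l) (hμ : 0 < μ) {x p : H}
    (hp : p ∈ A x) (n m : ℕ) :
    ‖(monotoneResolvent A l)^[n] x - (monotoneResolvent A μ)^[m] x‖ ^ 2 ≤
      ‖p‖ ^ 2 * ((n * l - m * μ) ^ 2 + n * l * l + m * μ * μ) := by
  rcases le_total μ l with h | h
  · exact hA.norm_iterate_sub_iterate_sq_le_of_le hμ h hp n m
  · rw [norm_sub_rev]
    exact (hA.norm_iterate_sub_iterate_sq_le_of_le hl h hp m n).trans_eq (by ring)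

theorem norm_iterate_sub_sq_le {l : ℝ} (hl : 0 < l) {x p w q : H} (hp : p ∈ A x) (hq : q ∈ A w)
    (n : ℕ) : ‖(monotoneResolvent A l)^[n] x - w‖ ^ 2 ≤
      ‖x - w‖ ^ 2 + 2 * (n * l) * ⟪q, w - x⟫ + 2 * ‖q‖ * ‖p‖ * (n * l) ^ 2 := by
  induction n with
  | zero => simp
  | succ n ih =>
    have hb := hA.norm_iterate_sub_le hl hp (n + 1)
    rw [Function.iterate_succ_apply'] at hb ⊢
    set z := (monotoneResolvent A l)^[n] x
    obtain ⟨r, hr, hz⟩ := hA.resolvent_spec hl z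
    set y := monotoneResolvent A l z
    have h1 := hA.monotone hr hq
    have h2 : z - w = (y - w) + l • r := by rw [← hz]; abel
    have h3 : ‖y - w‖ ^ 2 + 2 * l * ⟪r, y - w⟫ ≤ ‖z - w‖ ^ 2 := by
      rw [h2, norm_add_sq_real, real_inner_smul_right, real_inner_comm]
      nlinarith [sq_nonneg ‖l • r‖]
    have h4 : ⟪q, w - y⟫ = ⟪q, w - x⟫ - ⟪q, y - x⟫ := by
      rw [← inner_sub_right]; congr 1; abel
    have h5 : -⟪q, y - x⟫ ≤ ‖q‖ * ((n + 1 : ℕ) * l * ‖p‖) := by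
      rw [← inner_neg_right]
      refine (real_inner_le_norm _ _).trans ?_
      rw [norm_neg]
      gcongr
    have h6 : ⟪r - q, y - w⟫ = ⟪r, y - w⟫ + ⟪q, w - y⟫ := by
      rw [inner_sub_left, ← neg_sub y w, inner_neg_right]; ring
    rw [h6] at h1
    have h7 : ‖y - w‖ ^ 2 ≤ ‖z - w‖ ^ 2 + 2 * l * (⟪q, w - x⟫ + ‖q‖ * ((n + 1 : ℕ) * l * ‖p‖)) := by
      nlinarith
    refine h7.trans ((add_le_add_left ih _).trans ?_)
    have h8 : 0 ≤ ‖q‖ * ‖p‖ * (n * l ^ 2) := by positivity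
    push_cast
    nlinarith

theorem cauchySeq_iterate {x p : H} (hp : p ∈ A x) {t : ℝ} (ht : 0 ≤ t) :
    CauchySeq fun k : ℕ => (monotoneResolvent A (eulerStep k))^[⌊t * ((k : ℝ) + 1)⌋₊] x := by
  rw [cauchySeq_iff_tendsto_dist_atTop_0]
  have ha := tendsto_floor_mul_eulerStep ht
  set a : ℕ → ℝ := fun k => (⌊t * ((k : ℝ) + 1)⌋₊ : ℝ) * eulerStep k
  have h1 : Tendsto (fun n : ℕ × ℕ => n.1) atTop atTop := by
    rw [← prod_atTop_atTop_eq]; exact tendsto_fst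
  have h2 : Tendsto (fun n : ℕ × ℕ => n.2) atTop atTop := by
    rw [← prod_atTop_atTop_eq]; exact tendsto_snd
  have hlim : Tendsto (fun n : ℕ × ℕ => Real.sqrt (‖p‖ ^ 2 *
      ((a n.1 - a n.2) ^ 2 + a n.1 * eulerStep n.1 + a n.2 * eulerStep n.2))) atTop (𝓝 0) := by
    have := ((((ha.comp h1).sub (ha.comp h2)).pow 2).add
      ((ha.comp h1).mul (tendsto_eulerStep.comp h1))).add
      ((ha.comp h2).mul (tendsto_eulerStep.comp h2))
    simpa only [Function.comp_def, sub_self, ne_eq, OfNat.ofNat_ne_zero, not_false_eq_true,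
      zero_pow, mul_zero, add_zero, Real.sqrt_zero] using (this.const_mul (‖p‖ ^ 2)).sqrt
  refine squeeze_zero (fun _ => dist_nonneg) (fun n => ?_) hlim
  rw [dist_eq_norm]
  exact Real.le_sqrt_of_sq_le
    (hA.norm_iterate_sub_iterate_sq_le (eulerStep_pos _) (eulerStep_pos _) hp _ _)

section Flow

variable [CompleteSpace H] {x p : H} (hp : p ∈ A x)

include hp

theorem tendsto_iterate {t : ℝ} (ht : 0 ≤ t) {n : ℕ → ℕ}
    (hn : Tendsto (fun k => (n k : ℝ) * eulerStep k) atTop (𝓝 t)) :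
    Tendsto (fun k => (monotoneResolvent A (eulerStep k))^[n k] x) atTop
      (𝓝 (monotoneFlow A t x)) := by
  have h1 := tendsto_nhds_limUnder (cauchySeq_tendsto_of_complete (hA.cauchySeq_iterate hp ht))
  refine h1.congr_dist ?_
  have h2 := (((tendsto_floor_mul_eulerStep ht).sub hn).abs).mul_const ‖p‖
  rw [sub_self, abs_zero, zero_mul] at h2
  refine squeeze_zero (fun _ => dist_nonneg) (fun k => ?_) h2
  rw [dist_eq_norm]
  exact hA.norm_iterate_sub_iterate_le (eulerStep_pos k) hp _ _

theorem tendsto_iterate_floor {t : ℝ} (ht : 0 ≤ t) :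
    Tendsto (fun k : ℕ => (monotoneResolvent A (eulerStep k))^[⌊t * ((k : ℝ) + 1)⌋₊] x) atTop
      (𝓝 (monotoneFlow A t x)) :=
  hA.tendsto_iterate hp ht (tendsto_floor_mul_eulerStep ht)

theorem monotoneFlow_zero : monotoneFlow A 0 x = x :=
  tendsto_nhds_unique (hA.tendsto_iterate_floor hp le_rfl) (by simp)

theorem norm_monotoneFlow_sub_le {t s : ℝ} (ht : 0 ≤ t) (hs : 0 ≤ s) :
    ‖monotoneFlow A t x - monotoneFlow A s x‖ ≤ |t - s| * ‖p‖ :=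
  le_of_tendsto_of_tendsto'
    ((hA.tendsto_iterate_floor hp ht).sub (hA.tendsto_iterate_floor hp hs)).norm
    ((((tendsto_floor_mul_eulerStep ht).sub (tendsto_floor_mul_eulerStep hs)).abs).mul_const ‖p‖)
    fun k => hA.norm_iterate_sub_iterate_le (eulerStep_pos k) hp _ _

theorem exists_mem_monotoneFlow_norm_le {t : ℝ} (ht : 0 ≤ t) :
    ∃ q ∈ A (monotoneFlow A t x), ‖q‖ ≤ ‖p‖ :=
  hA.exists_mem_norm_le_of_tendsto (hA.tendsto_iterate_floor hp ht)
    fun k => hA.exists_mem_iterate_resolvent_norm_le (eulerStep_pos k) hp _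

theorem monotoneFlow_add {t s : ℝ} (ht : 0 ≤ t) (hs : 0 ≤ s) :
    monotoneFlow A (t + s) x = monotoneFlow A t (monotoneFlow A s x) := by
  obtain ⟨q, hq, -⟩ := hA.exists_mem_monotoneFlow_norm_le hp hs
  have hts := hA.tendsto_iterate hp (add_nonneg ht hs)
    (n := fun k => ⌊t * ((k : ℝ) + 1)⌋₊ + ⌊s * ((k : ℝ) + 1)⌋₊) (by
      simpa [add_mul] using
        (tendsto_floor_mul_eulerStep ht).add (tendsto_floor_mul_eulerStep hs))
  refine tendsto_nhds_unique hts ((hA.tendsto_iterate_floor hq ht).congr_dist ?_)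
  have hlim := (tendsto_iff_dist_tendsto_zero.1 (hA.tendsto_iterate_floor hp hs))
  refine squeeze_zero (fun _ => dist_nonneg) (fun k => ?_) hlim
  rw [Function.iterate_add_apply, dist_comm, dist_eq_norm, dist_eq_norm]
  exact hA.norm_iterate_resolvent_sub_le (eulerStep_pos k) _ _ _

theorem norm_monotoneFlow_sub_sq_le {t : ℝ} (ht : 0 ≤ t) {w q : H} (hq : q ∈ A w) :
    ‖monotoneFlow A t x - w‖ ^ 2 ≤
      ‖x - w‖ ^ 2 + 2 * t * ⟪q, w - x⟫ + 2 * ‖q‖ * ‖p‖ * t ^ 2 := by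
  have ha := tendsto_floor_mul_eulerStep ht
  exact le_of_tendsto_of_tendsto' (((hA.tendsto_iterate_floor hp ht).sub_const w).norm.pow 2)
    ((((ha.const_mul 2).mul_const ⟪q, w - x⟫).const_add (‖x - w‖ ^ 2)).add
      ((ha.pow 2).const_mul (2 * ‖q‖ * ‖p‖)))
    fun k => hA.norm_iterate_sub_sq_le (eulerStep_pos k) hp hq _

theorem norm_minSection_monotoneFlow_le {t : ℝ} (ht : 0 ≤ t) :
    ‖minSection A (monotoneFlow A t x)‖ ≤ ‖p‖ := by
  obtain ⟨q, hq, hqp⟩ := hA.exists_mem_monotoneFlow_norm_le hp ht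
  exact ((hA.minSection_spec ⟨q, hq⟩).2 q hq).trans hqp

theorem minSection_monotoneFlow_mem {t : ℝ} (ht : 0 ≤ t) :
    minSection A (monotoneFlow A t x) ∈ A (monotoneFlow A t x) := by
  obtain ⟨q, hq, -⟩ := hA.exists_mem_monotoneFlow_norm_le hp ht
  exact (hA.minSection_spec ⟨q, hq⟩).1

theorem antitone_norm_minSection_monotoneFlow :
    Antitone fun t : ℝ => ‖minSection A (monotoneFlow A (max t 0) x)‖ := by
  intro s t hst
  have hs : (0 : ℝ) ≤ max s 0 := le_max_right _ _
  have hst' : max s 0 ≤ max t 0 := max_le_max_right _ hst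
  have h := hA.monotoneFlow_add hp (sub_nonneg.2 hst') hs
  rw [sub_add_cancel] at h
  change ‖minSection A (monotoneFlow A (max t 0) x)‖ ≤ _
  rw [h]
  exact hA.norm_minSection_monotoneFlow_le (hA.minSection_monotoneFlow_mem hp hs)
    (sub_nonneg.2 hst')

theorem norm_secant_le {s r : ℝ} (hs : 0 ≤ s) (hsr : s < r) :
    ‖(r - s)⁻¹ • (monotoneFlow A s x - monotoneFlow A r x)‖ ≤
      ‖minSection A (monotoneFlow A s x)‖ := by
  have hh : 0 < r - s := sub_pos.2 hsr
  have hm := hA.minSection_monotoneFlow_mem hp hs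
  have h1 := hA.monotoneFlow_add hp hh.le hs
  rw [sub_add_cancel] at h1
  have h2 := hA.norm_monotoneFlow_sub_le hm le_rfl hh.le
  rw [hA.monotoneFlow_zero hm, ← h1, zero_sub, abs_neg, abs_of_pos hh] at h2
  rw [norm_smul, norm_inv, Real.norm_of_nonneg hh.le]
  exact inv_mul_le_of_le_mul₀ hh.le (norm_nonneg _) h2

theorem neg_le_inner_secant_sub {s r : ℝ} (hs : 0 ≤ s) (hsr : s < r) {w q : H} (hq : q ∈ A w) :
    -(‖q‖ * ‖p‖ * (r - s)) ≤
      ⟪(r - s)⁻¹ • (monotoneFlow A s x - monotoneFlow A r x) - q, monotoneFlow A s x - w⟫ := by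
  have hh : 0 < r - s := sub_pos.2 hsr
  have hm := hA.minSection_monotoneFlow_mem hp hs
  have hmp := hA.norm_minSection_monotoneFlow_le hp hs
  have h1 := hA.monotoneFlow_add hp hh.le hs
  rw [sub_add_cancel] at h1
  have h2 := hA.norm_monotoneFlow_sub_sq_le hm hh.le hq
  rw [← h1] at h2
  set y := monotoneFlow A s x
  set z := monotoneFlow A r x
  set h := r - s
  set P := h⁻¹ • (y - z) with hP
  have h3 : z - w = (y - w) - h • P := by
    rw [hP, smul_inv_smul₀ hh.ne']; abel
  rw [h3, norm_sub_sq_real, real_inner_smul_right, real_inner_comm P] at h2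
  have h4 : ⟪P - q, y - w⟫ = ⟪P, y - w⟫ + ⟪q, w - y⟫ := by
    rw [inner_sub_left, ← neg_sub y w, inner_neg_right]; ring
  have h5 : ‖q‖ * ‖minSection A y‖ * h ^ 2 ≤ ‖q‖ * ‖p‖ * h ^ 2 := by gcongr
  have h6 : 0 ≤ h * (⟪P - q, y - w⟫ + ‖q‖ * ‖p‖ * h) := by
    rw [h4]
    nlinarith [sq_nonneg ‖h • P‖]
  have := nonneg_of_mul_nonneg_right h6 hh
  linarith

theorem hasDerivAt_monotoneFlow {t : ℝ} (ht : 0 < t)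
    (hc : ContinuousAt (fun t : ℝ => ‖minSection A (monotoneFlow A (max t 0) x)‖) t) :
    HasDerivAt (fun t => monotoneFlow A t x) (-minSection A (monotoneFlow A t x)) t := by
  rw [hasDerivAt_iff_tendsto_slope]
  set f := fun t => monotoneFlow A t x with hf
  have hslope : slope f t = fun y => -(-slope f t y) := by simp
  rw [hslope]
  refine Tendsto.neg ?_
  have hsec : ∀ᶠ y in 𝓝[≠] t, 0 < y ∧ min t y < max t y ∧
      -slope f t y = (max t y - min t y)⁻¹ • (f (min t y) - f (max t y)) := by
    filter_upwards [self_mem_nhdsWithin, nhdsWithin_le_nhds (lt_mem_nhds ht)] with y hy hy0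
    refine ⟨hy0, min_lt_max.2 (Ne.symm hy), ?_⟩
    rcases lt_or_gt_of_ne hy with h | h
    · rw [max_eq_left h.le, min_eq_right h.le, slope_comm, slope_def_module, ← smul_neg, neg_sub]
    · rw [max_eq_right h.le, min_eq_left h.le, slope_def_module, ← smul_neg, neg_sub]
  refine hA.tendsto_minSection (c := fun y => ‖minSection A (f (max (min t y) 0))‖) ?_ ?_ ?_
  · filter_upwards [hsec] with y ⟨hy0, hlt, hy⟩
    have h0 : 0 ≤ min t y := le_min ht.le hy0.le
    rw [hy, max_eq_left h0]
    exact hA.norm_secant_le hp h0 hlt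
  · have h1 : Tendsto (fun y => min t y) (𝓝[≠] t) (𝓝 t) := by
      have : Continuous fun y : ℝ => min t y := by fun_prop
      simpa using (this.tendsto t).mono_left nhdsWithin_le_nhds
    have h2 := hc.tendsto.comp h1
    rw [max_eq_left ht.le] at h2
    exact h2
  · intro w q hq
    refine ⟨fun y => (‖q‖ * ‖p‖ + (‖p‖ + ‖q‖) * ‖p‖) * |y - t|, ?_, ?_⟩
    · have : Continuous fun y : ℝ => (‖q‖ * ‖p‖ + (‖p‖ + ‖q‖) * ‖p‖) * |y - t| := by fun_prop
      simpa using (this.tendsto t).mono_left nhdsWithin_le_nhds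
    · filter_upwards [hsec] with y ⟨hy0, hlt, hy⟩
      have h0 : 0 ≤ min t y := le_min ht.le hy0.le
      rw [hy]
      have h1 := hA.neg_le_inner_secant_sub hp h0 hlt hq
      have h2 := (hA.norm_secant_le hp h0 hlt).trans (hA.norm_minSection_monotoneFlow_le hp h0)
      change ‖(max t y - min t y)⁻¹ • (f (min t y) - f (max t y))‖ ≤ _ at h2
      change _ ≤ ⟪(max t y - min t y)⁻¹ • (f (min t y) - f (max t y)) - q, f (min t y) - w⟫ at h1
      set P := (max t y - min t y)⁻¹ • (f (min t y) - f (max t y))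
      have h3 : ‖f (min t y) - f t‖ ≤ |y - t| * ‖p‖ := by
        refine (hA.norm_monotoneFlow_sub_le hp h0 ht.le).trans ?_
        refine mul_le_mul_of_nonneg_right ?_ (norm_nonneg p)
        rcases le_total t y with h | h <;> simp [h]
      have h4 : ⟪P - q, f t - w⟫ = ⟪P - q, f (min t y) - w⟫ - ⟪P - q, f (min t y) - f t⟫ := by
        rw [← inner_sub_right]; congr 1; abel
      have h5 : ⟪P - q, f (min t y) - f t⟫ ≤ (‖p‖ + ‖q‖) * (|y - t| * ‖p‖) := by
        refine (real_inner_le_norm _ _).trans ?_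
        gcongr
        exact (norm_sub_le _ _).trans (by gcongr)
      rw [max_sub_min_eq_abs] at h1
      rw [h4]
      linarith

theorem ae_hasDerivAt_monotoneFlow :
    ∀ᵐ t ∂(volume.restrict (Set.Ioi (0 : ℝ))),
      HasDerivAt (fun t => monotoneFlow A t x) (-minSection A (monotoneFlow A t x)) t := by
  rw [ae_restrict_iff' measurableSet_Ioi]
  filter_upwards [(hA.antitone_norm_minSection_monotoneFlow hp).countable_not_continuousAt.ae_notMem
    volume] with t ht ht0
  exact hA.hasDerivAt_monotoneFlow hp ht0 (not_not.1 ht)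

end Flow

/-- Two Lipschitz solutions of `u' ∈ -A u` with the same initial value agree. -/
theorem eqOn_of_lipschitzOnWith {u v : ℝ → H} {K L : NNReal} (h0 : u 0 = v 0)
    (hu : LipschitzOnWith K u (Set.Ici 0)) (hv : LipschitzOnWith L v (Set.Ici 0))
    (hu' : ∀ᵐ t ∂(volume.restrict (Set.Ioi (0 : ℝ))),
      DifferentiableAt ℝ u t ∧ -deriv u t ∈ A (u t))
    (hv' : ∀ᵐ t ∂(volume.restrict (Set.Ioi (0 : ℝ))),
      DifferentiableAt ℝ v t ∧ -deriv v t ∈ A (v t)) :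
    Set.EqOn u v (Set.Ici 0) := by
  intro T hT
  have hT : 0 ≤ T := hT
  have hsub : uIcc 0 T ⊆ Set.Ici 0 := by rw [uIcc_of_le hT]; exact Icc_subset_Ici_self
  have hnorm : LipschitzOnWith (1 * (K + L)) (fun t => ‖u t - v t‖) (uIcc 0 T) :=
    (LipschitzWith.lipschitzOnWith lipschitzWith_one_norm).comp
      ((hu.sub hv).mono hsub) (fun _ _ => Set.mem_univ _)
  have hac := hnorm.absolutelyContinuousOnInterval.mul hnorm.absolutelyContinuousOnInterval
  have hint := hac.integral_deriv_eq_sub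
  have hle : ∫ t in (0 : ℝ)..T,
      deriv ((fun t => ‖u t - v t‖) * fun t => ‖u t - v t‖) t ≤ 0 := by
    rw [intervalIntegral.integral_of_le hT]
    refine integral_nonpos_of_ae ?_
    have hmono : volume.restrict (Set.Ioc 0 T) ≤ volume.restrict (Set.Ioi (0 : ℝ)) :=
      Measure.restrict_mono_set _ Ioc_subset_Ioi_self
    filter_upwards [ae_mono hmono hu', ae_mono hmono hv'] with t ⟨hdu, hAu⟩ ⟨hdv, hAv⟩
    have hd := (hdu.hasDerivAt.sub hdv.hasDerivAt).norm_sq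
    have heq : ((fun t => ‖u t - v t‖) * fun t => ‖u t - v t‖) = fun t => ‖(u - v) t‖ ^ 2 := by
      ext t; simp [sq]
    rw [heq, hd.deriv]
    have h1 := hA.monotone hAu hAv
    have h2 : -deriv u t - -deriv v t = -(deriv u t - deriv v t) := by abel
    rw [h2, inner_neg_left, real_inner_comm] at h1
    simp only [Pi.zero_apply, Pi.sub_apply]
    linarith
  rw [hint] at hle
  simp only [Pi.mul_apply, h0, sub_self, norm_zero, mul_zero, sub_zero] at hle
  have := mul_self_eq_zero.1 (le_antisymm hle (mul_self_nonneg _))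
  exact sub_eq_zero.1 (norm_eq_zero.1 this)

end IsMaximalMonotone

end MonotoneOperators

section Subdifferential

variable {H : Type*} [NormedAddCommGroup H] [InnerProductSpace ℝ H] {I : H → EReal}

theorem ne_top_of_mem_subdiff (hproper : ∃ x, I x ≠ ⊤) {x p : H} (hp : p ∈ subdiff I x) :
    I x ≠ ⊤ := by
  intro hx
  obtain ⟨w, hw⟩ := hproper
  have := hp w
  rw [hx, EReal.top_add_coe, top_le_iff] at this
  exact hw this

theorem toReal_add_inner_le_of_mem_subdiff (hbot : ∀ x, I x ≠ ⊥) (hproper : ∃ x, I x ≠ ⊤)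
    {x y p : H} (hp : p ∈ subdiff I x) (hy : I y ≠ ⊤) :
    (I x).toReal + ⟪p, y - x⟫ ≤ (I y).toReal := by
  have h := hp y
  rw [← EReal.coe_toReal (ne_top_of_mem_subdiff hproper hp) (hbot x),
    ← EReal.coe_toReal hy (hbot y)] at h
  exact_mod_cast h

theorem ERealConvex.ne_top_and_toReal_le (hbot : ∀ x, I x ≠ ⊥) (hconv : ERealConvex I) {x y : H}
    (hx : I x ≠ ⊤) (hy : I y ≠ ⊤) {a b : ℝ} (ha : 0 ≤ a) (hb : 0 ≤ b) (hab : a + b = 1) :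
    I (a • x + b • y) ≠ ⊤ ∧
      (I (a • x + b • y)).toReal ≤ a * (I x).toReal + b * (I y).toReal := by
  have h := hconv x y a b ha hb hab
  rw [← EReal.coe_toReal hx (hbot x), ← EReal.coe_toReal hy (hbot y), ← EReal.coe_mul,
    ← EReal.coe_mul, ← EReal.coe_add] at h
  have htop : I (a • x + b • y) ≠ ⊤ := ne_top_of_le_ne_top (EReal.coe_ne_top _) h
  refine ⟨htop, ?_⟩
  rw [← EReal.coe_toReal htop (hbot _)] at h
  exact_mod_cast h

/-- A convex lower semicontinuous functional plus a multiple `c > 0` of the squared distance to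
`x` attains its minimum. -/
theorem exists_forall_toReal_add_sq_le [CompleteSpace H] (hbot : ∀ x, I x ≠ ⊥)
    (hproper : ∃ x, I x ≠ ⊤) (hconv : ERealConvex I) (hlsc : LowerSemicontinuous I) {u₀ p₀ : H}
    (hp₀ : p₀ ∈ subdiff I u₀) {c : ℝ} (hc : 0 < c) (x : H) :
    ∃ y, I y ≠ ⊤ ∧ ∀ w, I w ≠ ⊤ →
      (I y).toReal + c * ‖y - x‖ ^ 2 ≤ (I w).toReal + c * ‖w - x‖ ^ 2 := by
  set Φ : H → ℝ := fun w => (I w).toReal + c * ‖w - x‖ ^ 2 with hΦ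
  set D : Set H := {w | I w ≠ ⊤}
  have hbdd : BddBelow (Φ '' D) := by
    refine ⟨(I u₀).toReal + ⟪p₀, x - u₀⟫ - ‖p₀‖ ^ 2 / (4 * c), ?_⟩
    rintro _ ⟨w, hw, rfl⟩
    have h1 := toReal_add_inner_le_of_mem_subdiff hbot hproper hp₀ hw
    have h2 : ⟪p₀, w - u₀⟫ = ⟪p₀, w - x⟫ + ⟪p₀, x - u₀⟫ := by
      rw [← inner_add_right]; congr 1; abel
    have h3 := neg_le_of_abs_le (abs_real_inner_le_norm p₀ (w - x))
    have h4 : 0 ≤ c * ‖w - x‖ ^ 2 - ‖p₀‖ * ‖w - x‖ + ‖p₀‖ ^ 2 / (4 * c) := by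
      have : c * ‖w - x‖ ^ 2 - ‖p₀‖ * ‖w - x‖ + ‖p₀‖ ^ 2 / (4 * c) =
          c * (‖w - x‖ - ‖p₀‖ / (2 * c)) ^ 2 := by field_simp; ring
      rw [this]; positivity
    simp only [hΦ]
    linarith
  have hne : (Φ '' D).Nonempty := Set.Nonempty.image Φ hproper
  set m := sInf (Φ '' D)
  have hm : ∀ w, I w ≠ ⊤ → m ≤ Φ w := fun w hw => csInf_le hbdd ⟨w, hw, rfl⟩
  have hseq : ∀ n : ℕ, ∃ y, I y ≠ ⊤ ∧ Φ y < m + 1 / ((n : ℝ) + 1) := fun n => by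
    obtain ⟨_, ⟨y, hy, rfl⟩, h⟩ := exists_lt_of_csInf_lt hne
      (lt_add_of_pos_right m (Nat.one_div_pos_of_nat (α := ℝ) (n := n)))
    exact ⟨y, hy, h⟩
  choose y hyD hyΦ using hseq
  have hmid : ∀ a b, I a ≠ ⊤ → I b ≠ ⊤ →
      c * ‖a - b‖ ^ 2 ≤ 2 * (Φ a - m) + 2 * (Φ b - m) := fun a b ha hb => by
    obtain ⟨h1, h2⟩ := hconv.ne_top_and_toReal_le hbot ha hb (a := 1 / 2) (b := 1 / 2)
      (by norm_num) (by norm_num) (by norm_num)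
    have h3 := hm _ h1
    have h4 := parallelogram_law_with_norm ℝ (a - x) (b - x)
    have h5 : ‖(1 / 2 : ℝ) • a + (1 / 2 : ℝ) • b - x‖ = 1 / 2 * ‖(a - x) + (b - x)‖ := by
      rw [show (1 / 2 : ℝ) • a + (1 / 2 : ℝ) • b - x = (1 / 2 : ℝ) • ((a - x) + (b - x)) by module,
        norm_smul, Real.norm_of_nonneg (by norm_num)]
    rw [sub_sub_sub_cancel_right] at h4
    simp only [hΦ] at h3 ⊢
    rw [h5] at h3
    have h6 : c * (‖a - x + (b - x)‖ ^ 2 + ‖a - b‖ ^ 2) =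
        c * (2 * (‖a - x‖ ^ 2 + ‖b - x‖ ^ 2)) := by rw [h4]
    nlinarith
  have hcauchy : CauchySeq y := by
    rw [cauchySeq_iff_tendsto_dist_atTop_0]
    have h0 := tendsto_one_div_add_atTop_nhds_zero_nat (𝕜 := ℝ)
    have h1 : Tendsto (fun n : ℕ × ℕ => n.1) atTop atTop := by
      rw [← prod_atTop_atTop_eq]; exact tendsto_fst
    have h2 : Tendsto (fun n : ℕ × ℕ => n.2) atTop atTop := by
      rw [← prod_atTop_atTop_eq]; exact tendsto_snd
    have hlim : Tendsto (fun n : ℕ × ℕ => Real.sqrt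
        ((2 * (1 / ((n.1 : ℝ) + 1)) + 2 * (1 / ((n.2 : ℝ) + 1))) / c)) atTop (𝓝 0) := by
      have := ((((h0.comp h1).const_mul 2).add ((h0.comp h2).const_mul 2)).div_const c).sqrt
      simpa only [Function.comp_def, mul_zero, add_zero, zero_div, Real.sqrt_zero] using this
    refine squeeze_zero (fun _ => dist_nonneg) (fun n => ?_) hlim
    rw [dist_eq_norm]
    refine Real.le_sqrt_of_sq_le ?_
    rw [le_div_iff₀ hc]
    have := hmid _ _ (hyD n.1) (hyD n.2)
    linarith [hyΦ n.1, hyΦ n.2]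
  obtain ⟨z, hz⟩ := cauchySeq_tendsto_of_complete hcauchy
  have hΦlim : Tendsto (fun n => Φ (y n)) atTop (𝓝 m) :=
    tendsto_of_tendsto_of_tendsto_of_le_of_le tendsto_const_nhds
      (by simpa only [add_zero] using
        (tendsto_one_div_add_atTop_nhds_zero_nat (𝕜 := ℝ)).const_add m)
      (fun n => hm _ (hyD n)) (fun n => (hyΦ n).le)
  have hflim : Tendsto (fun n => (I (y n)).toReal) atTop (𝓝 (m - c * ‖z - x‖ ^ 2)) := by
    have := hΦlim.sub (((hz.sub_const x).norm.pow 2).const_mul c)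
    simpa only [hΦ, add_sub_cancel_right] using this
  have hIz : I z ≤ ((m - c * ‖z - x‖ ^ 2 : ℝ) : EReal) := by
    by_contra! hlt
    obtain ⟨r, hr1, hr2⟩ := EReal.lt_iff_exists_real_btwn.1 hlt
    have h1 := hz.eventually (hlsc z _ hr2)
    have h2 := hflim.eventually (gt_mem_nhds (EReal.coe_lt_coe_iff.1 hr1))
    obtain ⟨n, h3, h4⟩ := (h1.and h2).exists
    rw [← EReal.coe_toReal (hyD n) (hbot _)] at h3
    exact lt_asymm h4 (EReal.coe_lt_coe_iff.1 h3)
  have hzD : I z ≠ ⊤ := ne_top_of_le_ne_top (EReal.coe_ne_top _) hIz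
  refine ⟨z, hzD, fun w hw => ?_⟩
  rw [← EReal.coe_toReal hzD (hbot z)] at hIz
  have h1 := EReal.coe_le_coe_iff.1 hIz
  have h2 := hm w hw
  simp only [hΦ] at h2
  linarith

/-- The subdifferential of a proper convex lower semicontinuous functional is maximal monotone. -/
theorem isMaximalMonotone_subdiff [CompleteSpace H] (hbot : ∀ x, I x ≠ ⊥)
    (hproper : ∃ x, I x ≠ ⊤) (hconv : ERealConvex I) (hlsc : LowerSemicontinuous I)
    {u₀ : H} (hu₀ : (subdiff I u₀).Nonempty) : IsMaximalMonotone (subdiff I) where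
  monotone {x y p q} hp hq := by
    have h1 := toReal_add_inner_le_of_mem_subdiff hbot hproper hp (ne_top_of_mem_subdiff hproper hq)
    have h2 := toReal_add_inner_le_of_mem_subdiff hbot hproper hq (ne_top_of_mem_subdiff hproper hp)
    rw [← neg_sub x y, inner_neg_right] at h1
    rw [inner_sub_left]
    linarith
  range {l} hl x := by
    obtain ⟨p₀, hp₀⟩ := hu₀
    obtain ⟨y, hy, hmin⟩ := exists_forall_toReal_add_sq_le hbot hproper hconv hlsc hp₀
      (c := (2 * l)⁻¹) (by positivity) x
    refine ⟨y, l⁻¹ • (x - y), fun w => ?_, by rw [smul_inv_smul₀ hl.ne']; abel⟩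
    rcases eq_or_ne (I w) ⊤ with hw | hw
    · rw [hw]; exact le_top
    rw [← EReal.coe_toReal hy (hbot y), ← EReal.coe_toReal hw (hbot w), ← EReal.coe_add,
      EReal.coe_le_coe_iff]
    have key : ∀ θ ∈ Set.Ioc (0 : ℝ) 1, (I y).toReal + ⟪l⁻¹ • (x - y), w - y⟫ - (I w).toReal ≤
        θ * ((2 * l)⁻¹ * ‖w - y‖ ^ 2) := fun θ hθ => by
      obtain ⟨h1, h2⟩ := hconv.ne_top_and_toReal_le hbot hy hw (a := 1 - θ) (b := θ)
        (sub_nonneg.2 hθ.2) hθ.1.le (by ring)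
      have h3 := hmin _ h1
      have h4 : (1 - θ) • y + θ • w - x = (y - x) + θ • (w - y) := by module
      rw [h4, norm_add_sq_real, real_inner_smul_right, norm_smul, Real.norm_of_nonneg hθ.1.le] at h3
      have h5 : ⟪l⁻¹ • (x - y), w - y⟫ = -((2 * l)⁻¹ * (2 * ⟪y - x, w - y⟫)) := by
        rw [← neg_sub y x, smul_neg, inner_neg_left, real_inner_smul_left]
        field_simp
      rw [h5]
      refine le_of_mul_le_mul_left ?_ hθ.1
      nlinarith
    have hlim : Tendsto (fun θ : ℝ => θ * ((2 * l)⁻¹ * ‖w - y‖ ^ 2)) (𝓝[>] 0) (𝓝 0) := by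
      have : Continuous fun θ : ℝ => θ * ((2 * l)⁻¹ * ‖w - y‖ ^ 2) := by fun_prop
      simpa only [zero_mul] using (this.tendsto 0).mono_left nhdsWithin_le_nhds
    have := ge_of_tendsto hlim (by
      filter_upwards [Ioc_mem_nhdsGT (zero_lt_one' ℝ)] with θ hθ using key θ hθ)
    linarith

end Subdifferential

variable {H : Type*} [NormedAddCommGroup H] [InnerProductSpace ℝ H] [CompleteSpace H]

/-- For each `u₀ ∈ D(∂I)` there is a unique Lipschitz function
`u : [0,∞) → H` with `u(0) = u₀`, `u(t) ∈ D(∂I)` for all `t ≥ 0`, `u` differentiable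
a.e. with `−u'(t) ∈ ∂I(u(t))` a.e. on `(0,∞)`; moreover
`‖u(t) − u(s)‖ ≤ ‖A⁰(u₀)‖·|t − s|` where `A⁰(u₀)` is the minimal-norm element of
`∂I(u₀)`. -/
theorem gradient_flow_exists_unique_of_mem_domSubdiff
    (I : H → EReal) (hbot : ∀ x, I x ≠ ⊥) (hproper : ∃ x, I x ≠ ⊤)
    (hconv : ERealConvex I) (hlsc : LowerSemicontinuous I)
    (u₀ : H) (hu₀ : (subdiff I u₀).Nonempty) :
    ∃ u : ℝ → H,
      (u 0 = u₀ ∧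
       (∃ K : NNReal, LipschitzOnWith K u (Set.Ici 0)) ∧
       (∀ t : ℝ, 0 ≤ t → (subdiff I (u t)).Nonempty) ∧
       (∀ᵐ t ∂(volume.restrict (Set.Ioi (0 : ℝ))),
         DifferentiableAt ℝ u t ∧ -deriv u t ∈ subdiff I (u t)) ∧
       (∃ z0 ∈ subdiff I u₀, (∀ z ∈ subdiff I u₀, ‖z0‖ ≤ ‖z‖) ∧
         ∀ t ∈ Set.Ici (0 : ℝ), ∀ s ∈ Set.Ici (0 : ℝ),
           ‖u t - u s‖ ≤ ‖z0‖ * |t - s|)) ∧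
      ∀ v : ℝ → H,
        (v 0 = u₀ ∧
         (∃ K : NNReal, LipschitzOnWith K v (Set.Ici 0)) ∧
         (∀ t : ℝ, 0 ≤ t → (subdiff I (v t)).Nonempty) ∧
         (∀ᵐ t ∂(volume.restrict (Set.Ioi (0 : ℝ))),
           DifferentiableAt ℝ v t ∧ -deriv v t ∈ subdiff I (v t))) →
        Set.EqOn u v (Set.Ici 0) := by
  have hA := isMaximalMonotone_subdiff hbot hproper hconv hlsc hu₀
  obtain ⟨hp, hmin⟩ := hA.minSection_spec hu₀
  have hLip : ∀ t ∈ Set.Ici (0 : ℝ), ∀ s ∈ Set.Ici (0 : ℝ),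
      ‖monotoneFlow (subdiff I) t u₀ - monotoneFlow (subdiff I) s u₀‖ ≤
        ‖minSection (subdiff I) u₀‖ * |t - s| := fun t ht s hs => by
    rw [mul_comm]
    exact hA.norm_monotoneFlow_sub_le hp ht hs
  have hLip' : LipschitzOnWith ‖minSection (subdiff I) u₀‖₊
      (fun t => monotoneFlow (subdiff I) t u₀) (Set.Ici 0) :=
    LipschitzOnWith.of_dist_le_mul fun t ht s hs => by
      simpa only [dist_eq_norm, Real.norm_eq_abs, coe_nnnorm] using hLip t ht s hs
  have hder : ∀ᵐ t ∂(volume.restrict (Set.Ioi (0 : ℝ))),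
      DifferentiableAt ℝ (fun t => monotoneFlow (subdiff I) t u₀) t ∧
        -deriv (fun t => monotoneFlow (subdiff I) t u₀) t ∈
          subdiff I (monotoneFlow (subdiff I) t u₀) := by
    filter_upwards [hA.ae_hasDerivAt_monotoneFlow hp, ae_restrict_mem measurableSet_Ioi]
      with t ht ht0
    refine ⟨ht.differentiableAt, ?_⟩
    rw [ht.deriv, neg_neg]
    exact hA.minSection_monotoneFlow_mem hp (le_of_lt ht0)
  refine ⟨fun t => monotoneFlow (subdiff I) t u₀, ⟨hA.monotoneFlow_zero hp, ⟨_, hLip'⟩,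
    fun t ht => ⟨_, hA.minSection_monotoneFlow_mem hp ht⟩, hder, _, hp, hmin, hLip⟩, ?_⟩
  rintro v ⟨hv0, ⟨L, hvL⟩, -, hv'⟩
  exact hA.eqOn_of_lipschitzOnWith ((hA.monotoneFlow_zero hp).trans hv0.symm) hLip' hvL hder hv'
end

section
/- Minimal selection principle: let H be a real Hilbert space and I : H → ℝ ∪ {+∞} proper, convex and lower semicontinuous. Let u : (0,∞) → H be locally Lipschitz, suppose u(t) ∈ D(∂I) for all t > 0, and suppose −u'(t) ∈ ∂I(u(t)) for a.e. t > 0. Then for a.e. t > 0, −u'(t) = A⁰(u(t)), i.e. −u'(t) is the element of minimal norm of ∂I(u(t)). -/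
open MeasureTheory Filter Topology Set
open scoped RealInnerProductSpace

variable {H : Type*} [NormedAddCommGroup H] [InnerProductSpace ℝ H] [CompleteSpace H]

theorem subdiff_ne_top {E : Type*} [NormedAddCommGroup E] [InnerProductSpace ℝ E]
    {I : E → EReal} (hproper : ∃ x, I x ≠ ⊤) {x z : E} (hz : z ∈ subdiff I x) : I x ≠ ⊤ := by
  obtain ⟨w, hw⟩ := hproper
  intro hx
  have h := hz w
  rw [hx, EReal.top_add_coe] at h
  exact hw (top_le_iff.mp h)

theorem toReal_add_inner_le_of_mem_subdiff_s12
    {E : Type*} [NormedAddCommGroup E] [InnerProductSpace ℝ E]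
    {I : E → EReal} (hbot : ∀ x, I x ≠ ⊥) {x y z : E} (hx : I x ≠ ⊤) (hy : I y ≠ ⊤)
    (hz : z ∈ subdiff I x) : (I x).toReal + ⟪z, y - x⟫ ≤ (I y).toReal := by
  have h := hz y
  rw [← EReal.coe_toReal hx (hbot x), ← EReal.coe_toReal hy (hbot y)] at h
  exact_mod_cast h

/-- If `t` minimizes `g - ⟪z, u⟫` locally for each `z ∈ S` and `-u'(t) ∈ S`, then `-u'(t)` has
minimal norm in `S`. -/
theorem norm_deriv_le_of_isLocalMin_sub_inner
    {E : Type*} [NormedAddCommGroup E] [InnerProductSpace ℝ E] {S : Set E}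
    {g : ℝ → ℝ} {u : ℝ → E} {t : ℝ} (hg : DifferentiableAt ℝ g t) (hu : DifferentiableAt ℝ u t)
    (hmin : ∀ z ∈ S, IsLocalMin (fun s => g s - ⟪z, u s⟫) t) (hS : -deriv u t ∈ S)
    {z : E} (hz : z ∈ S) : ‖deriv u t‖ ≤ ‖z‖ := by
  have key : ∀ z ∈ S, deriv g t = ⟪z, deriv u t⟫ := fun z hz => by
    have h := (hasDerivAt_const t z).inner ℝ hu.hasDerivAt
    have h0 := (hmin z hz).hasDerivAt_eq_zero (hg.hasDerivAt.sub h)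
    simp only [inner_zero_left, add_zero] at h0
    linarith
  have h1 := key _ hS
  rw [key z hz, inner_neg_left, real_inner_self_eq_norm_sq] at h1
  have h2 := abs_le.mp (abs_real_inner_le_norm z (deriv u t))
  by_contra! hlt
  nlinarith [norm_nonneg z, norm_nonneg (deriv u t)]

/-- Along a Lipschitz curve in `D(∂I)`, the energy is Lipschitz on the set of times where
`-u'(t) ∈ ∂I(u(t))`. -/
theorem lipschitzOnWith_toReal_comp_of_neg_deriv_mem_subdiff
    {E : Type*} [NormedAddCommGroup E] [InnerProductSpace ℝ E]
    {I : E → EReal} (hbot : ∀ x, I x ≠ ⊥) {u : ℝ → E} {a b : ℝ} {K : NNReal}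
    (hu : LipschitzOnWith K u (Icc a b)) (hfin : ∀ t ∈ Ioo a b, I (u t) ≠ ⊤) :
    LipschitzOnWith (K * K) (fun t => (I (u t)).toReal)
      (Ioo a b ∩ {t | -deriv u t ∈ subdiff I (u t)}) := by
  refine LipschitzOnWith.of_le_add_mul _ fun x hx y hy => ?_
  have h := toReal_add_inner_le_of_mem_subdiff_s12 hbot (hfin x hx.1) (hfin y hy.1) hx.2
  have h1 : ‖deriv u x‖ ≤ K :=
    norm_deriv_le_of_lipschitzOn (Icc_mem_nhds hx.1.1 hx.1.2) hu
  have h2 : ‖u y - u x‖ ≤ K * dist x y := by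
    rw [← dist_eq_norm, dist_comm x y]
    exact hu.dist_le_mul y (Ioo_subset_Icc_self hy.1) x (Ioo_subset_Icc_self hx.1)
  have h3 := (abs_le.mp (abs_real_inner_le_norm (-deriv u x) (u y - u x))).1
  rw [norm_neg] at h3
  have h4 := mul_le_mul h1 h2 (norm_nonneg _) K.coe_nonneg
  push_cast
  linarith

/-- A Lipschitz solution of `-u'(t) ∈ ∂I(u(t))` on an interval has minimal speed almost everywhere. -/
theorem ae_norm_deriv_le_of_lipschitzOnWith
    {E : Type*} [NormedAddCommGroup E] [InnerProductSpace ℝ E]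
    {I : E → EReal} (hbot : ∀ x, I x ≠ ⊥) {u : ℝ → E} {a b : ℝ} {K : NNReal}
    (hu : LipschitzOnWith K u (Icc a b)) (hfin : ∀ t ∈ Ioo a b, I (u t) ≠ ⊤)
    (hflow : ∀ᵐ t, t ∈ Ioo a b → DifferentiableAt ℝ u t ∧ -deriv u t ∈ subdiff I (u t)) :
    ∀ᵐ t, t ∈ Ioo a b → ∀ z ∈ subdiff I (u t), ‖deriv u t‖ ≤ ‖z‖ := by
  set G : Set ℝ := Ioo a b ∩ {t | -deriv u t ∈ subdiff I (u t)}
  obtain ⟨g, hg, hgφ⟩ :=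
    (lipschitzOnWith_toReal_comp_of_neg_deriv_mem_subdiff hbot hu hfin).extend_real
  have hdense : Ioo a b ⊆ closure G := by
    have hd := (Measure.dense_of_ae hflow).open_subset_closure_inter (isOpen_Ioo (a := a) (b := b))
    exact hd.trans (closure_mono fun t ht => ⟨ht.1, (ht.2 ht.1).2⟩)
  have hclosure : closure G ⊆ Icc a b :=
    closure_minimal (inter_subset_left.trans Ioo_subset_Icc_self) isClosed_Icc
  filter_upwards [hflow, hg.ae_differentiableAt] with t ht hgt hab z hz
  refine norm_deriv_le_of_isLocalMin_sub_inner hgt (ht hab).1 (fun z hz => ?_) (ht hab).2 hz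
  have hle : ∀ s ∈ closure G, g t - ⟪z, u t⟫ ≤ g s - ⟪z, u s⟫ := by
    refine fun s hs => le_on_closure (f := fun _ => g t - ⟪z, u t⟫)
      (g := fun s => g s - ⟪z, u s⟫) (fun s hs => ?_) continuousOn_const ?_ hs
    · have h := toReal_add_inner_le_of_mem_subdiff_s12 hbot (hfin t hab) (hfin s hs.1) hz
      have h1 : (I (u t)).toReal = g t := hgφ ⟨hab, (ht hab).2⟩
      have h2 : (I (u s)).toReal = g s := hgφ hs
      rw [inner_sub_right, h1, h2] at h
      linarith
    · exact hg.continuous.continuousOn.sub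
        (continuousOn_const.inner (hu.continuousOn.mono hclosure))
  filter_upwards [Ioo_mem_nhds hab.1 hab.2] with s hs using hle s (hdense hs)

/-- minimal selection principle. If `u : (0,∞) → H` is locally
Lipschitz, `u(t) ∈ D(∂I)` for all `t > 0`, and `−u'(t) ∈ ∂I(u(t))` a.e., then for a.e.
`t > 0` the velocity `−u'(t)` is the minimal-norm element `A⁰(u(t))` of `∂I(u(t))`. -/
theorem minimal_selection_principle
    (I : H → EReal) (hbot : ∀ x, I x ≠ ⊥) (hproper : ∃ x, I x ≠ ⊤)
    (hconv : ERealConvex I) (hlsc : LowerSemicontinuous I)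
    (u : ℝ → H)
    (hlip : ∀ a b : ℝ, 0 < a → a ≤ b →
      ∃ K : NNReal, LipschitzOnWith K u (Set.Icc a b))
    (hdom : ∀ t : ℝ, 0 < t → (subdiff I (u t)).Nonempty)
    (hflow : ∀ᵐ t ∂(volume.restrict (Set.Ioi (0 : ℝ))),
      DifferentiableAt ℝ u t ∧ -deriv u t ∈ subdiff I (u t)) :
    ∀ᵐ t ∂(volume.restrict (Set.Ioi (0 : ℝ))),
      -deriv u t ∈ subdiff I (u t) ∧ ∀ z ∈ subdiff I (u t), ‖deriv u t‖ ≤ ‖z‖ := by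
  rw [ae_restrict_iff' measurableSet_Ioi] at hflow ⊢
  have hloc : ∀ n : ℕ, ∀ᵐ t, t ∈ Ioo (1 / ((n : ℝ) + 1)) ((n : ℝ) + 1) →
      ∀ z ∈ subdiff I (u t), ‖deriv u t‖ ≤ ‖z‖ := fun n => by
    have hpos : 0 < 1 / ((n : ℝ) + 1) := by positivity
    have hle : 1 / ((n : ℝ) + 1) ≤ (n : ℝ) + 1 := by
      have hn : (0 : ℝ) ≤ n := n.cast_nonneg
      rw [div_le_iff₀ (by positivity)]
      nlinarith
    obtain ⟨K, hK⟩ := hlip _ _ hpos hle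
    refine ae_norm_deriv_le_of_lipschitzOnWith hbot hK (fun t ht => ?_) ?_
    · exact subdiff_ne_top hproper (hdom t (hpos.trans ht.1)).some_mem
    · filter_upwards [hflow] with t ht h using ht (hpos.trans h.1)
  filter_upwards [hflow, ae_all_iff.mpr hloc] with t ht hn h0
  refine ⟨(ht h0).2, ?_⟩
  obtain ⟨n, hn1⟩ := exists_nat_one_div_lt (mem_Ioi.mp h0)
  obtain ⟨m, hm⟩ := exists_nat_gt t
  refine hn (max n m) ⟨lt_of_le_of_lt ?_ hn1, ?_⟩
  · exact one_div_le_one_div_of_le (by positivity) (by gcongr; exact le_max_left n m)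
  · have : (m : ℝ) ≤ (max n m : ℕ) := by exact_mod_cast le_max_right n m
    linarith
end

section
/- Equivalence of integral monotonicity and nonnegative second variation: let Ω ⊂ ℝⁿ be a nonempty bounded open set and let f : Ω × ℝ^{N×n} → ℝ be measurable in x with f(x,·) of class C² for a.e. x ∈ Ω. Assume |D_ξ f(x,ξ)| ≤ c₂(x) + c₃(ξ) for a.e. x and all ξ, with 0 ≤ c₂ ∈ L¹(Ω) and c₃ : ℝ^{N×n} → [0,∞) continuous, and assume that for every compact K ⊂ ℝ^{N×n} the function x ↦ sup_{ξ∈K} |D²_ξ f(x,ξ)| belongs to L¹(Ω). Then the following are equivalent: (a) ∫_Ω [D_ξf(x, Dψ(x)+Dφ(x)) − D_ξf(x, Dψ(x))] : Dφ(x) dx ≥ 0 for all φ, ψ ∈ C_c^∞(Ω;ℝᴺ); (b) ∫_Ω D²_ξ f(x, Dψ(x))(Dφ(x), Dφ(x)) dx ≥ 0 for all φ, ψ ∈ C_c^∞(Ω;ℝᴺ), where D²_ξ f(x,ξ)(η,η) = Σ_{i,k=1}^N Σ_{j,l=1}^n (∂²f(x,ξ)/∂ξ_{ij}∂ξ_{kl})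 η_{ij} η_{kl}. -/
open MeasureTheory

/-- A test map: smooth and compactly supported inside `Ω`. -/
def TestMap {n N : ℕ} (Ω : Set (Fin n → ℝ)) (φ : (Fin n → ℝ) → Fin N → ℝ) : Prop :=
  ContDiff ℝ (⊤ : ℕ∞) φ ∧ HasCompactSupport φ ∧ tsupport φ ⊆ Ω

/-- The Jacobian matrix `Dφ(x) ∈ ℝ^{N×n}` of `φ : ℝⁿ → ℝᴺ` at `x`:
`(Dφ(x))_{ij} = ∂φⁱ/∂x_j`. Matrices are modeled as `Fin N → Fin n → ℝ`. -/
noncomputable def jac {n N : ℕ} (φ : (Fin n → ℝ) → Fin N → ℝ) (x : Fin n → ℝ) :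
    Fin N → Fin n → ℝ :=
  fun i j => fderiv ℝ φ x (Pi.single j 1) i

/-- The Frobenius inner product `ξ : η = ∑_{i,j} ξ_{ij} η_{ij}` on `ℝ^{N×n}`. -/
def mdot {n N : ℕ} (ξ η : Fin N → Fin n → ℝ) : ℝ := ∑ i, ∑ j, ξ i j * η i j

/-- The standard basis matrix `e_{ij}` of `ℝ^{N×n}`. -/
def eMat {n N : ℕ} (i : Fin N) (j : Fin n) : Fin N → Fin n → ℝ :=
  Pi.single i (Pi.single j 1)

/-- The gradient matrix `D_ξ f(x, ξ) ∈ ℝ^{N×n}` of `f(x, ·)` at `ξ`. -/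
noncomputable def gradx {n N : ℕ} (f : (Fin n → ℝ) → (Fin N → Fin n → ℝ) → ℝ)
    (x : Fin n → ℝ) (ξ : Fin N → Fin n → ℝ) : Fin N → Fin n → ℝ :=
  fun i j => fderiv ℝ (f x) ξ (eMat i j)

/-- The second partial derivative `∂²f(x,ξ)/∂ξ_{ij} ∂ξ_{kl}`. -/
noncomputable def hessc {n N : ℕ} (f : (Fin n → ℝ) → (Fin N → Fin n → ℝ) → ℝ)
    (x : Fin n → ℝ) (ξ : Fin N → Fin n → ℝ)
    (i : Fin N) (j : Fin n) (k : Fin N) (l : Fin n) : ℝ :=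
  fderiv ℝ (fun ζ => fderiv ℝ (f x) ζ (eMat k l)) ξ (eMat i j)

/-- The Hessian quadratic form
`D²_ξ f(x,ξ)(η,η) = ∑_{i,j,k,l} (∂²f/∂ξ_{ij}∂ξ_{kl}) η_{ij} η_{kl}`. -/
noncomputable def hessQ {n N : ℕ} (f : (Fin n → ℝ) → (Fin N → Fin n → ℝ) → ℝ)
    (x : Fin n → ℝ) (ξ η : Fin N → Fin n → ℝ) : ℝ :=
  ∑ i, ∑ j, ∑ k, ∑ l, hessc f x ξ i j k l * η i j * η k l

section Algebra

variable {n N : ℕ}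

theorem sum_smul_eMat (η : Fin N → Fin n → ℝ) : ∑ i, ∑ j, η i j • eMat i j = η := by
  ext a b
  simp [eMat, Finset.sum_apply, Pi.single_apply, apply_ite, ite_apply]

theorem map_eq_sum_eMat (A : (Fin N → Fin n → ℝ) →L[ℝ] ℝ) (η : Fin N → Fin n → ℝ) :
    A η = ∑ i, ∑ j, A (eMat i j) * η i j := by
  conv_lhs => rw [← sum_smul_eMat η]
  simp [map_sum, mul_comm]

theorem mdot_gradx (f : (Fin n → ℝ) → (Fin N → Fin n → ℝ) → ℝ) (x : Fin n → ℝ)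
    (ξ η : Fin N → Fin n → ℝ) : mdot (gradx f x ξ) η = fderiv ℝ (f x) ξ η :=
  (map_eq_sum_eMat _ _).symm

theorem mdot_sub_left (ξ ζ η : Fin N → Fin n → ℝ) :
    mdot (ξ - ζ) η = mdot ξ η - mdot ζ η := by
  simp [mdot, sub_mul, Finset.sum_sub_distrib]

theorem mdot_smul_right (c : ℝ) (ξ η : Fin N → Fin n → ℝ) :
    mdot ξ (c • η) = c * mdot ξ η := by
  simp only [mdot, Finset.mul_sum, Pi.smul_apply, smul_eq_mul]
  exact Finset.sum_congr rfl fun i _ => Finset.sum_congr rfl fun j _ => by ring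

theorem abs_mdot_le (ξ η : Fin N → Fin n → ℝ) :
    |mdot ξ η| ≤ N * n * (√(mdot ξ ξ) * ‖η‖) := by
  have key : ∀ i j, |ξ i j * η i j| ≤ √(mdot ξ ξ) * ‖η‖ := fun i j => by
    rw [abs_mul]
    refine mul_le_mul (Real.abs_le_sqrt ?_) ?_ (abs_nonneg _) (Real.sqrt_nonneg _)
    · rw [mdot, pow_two]
      refine le_trans ?_ (Finset.single_le_sum (f := fun i => ∑ j, ξ i j * ξ i j)
        (fun i _ => Finset.sum_nonneg fun j _ => mul_self_nonneg _) (Finset.mem_univ i))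
      exact Finset.single_le_sum (f := fun j => ξ i j * ξ i j)
        (fun j _ => mul_self_nonneg _) (Finset.mem_univ j)
    · exact (norm_le_pi_norm (η i) j).trans (norm_le_pi_norm η i)
  calc |mdot ξ η| ≤ ∑ i, ∑ j, |ξ i j * η i j| :=
        (Finset.abs_sum_le_sum_abs _ _).trans
          (Finset.sum_le_sum fun i _ => Finset.abs_sum_le_sum_abs _ _)
    _ ≤ ∑ _i : Fin N, ∑ _j : Fin n, √(mdot ξ ξ) * ‖η‖ :=
        Finset.sum_le_sum fun i _ => Finset.sum_le_sum fun j _ => key i j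
    _ = N * n * (√(mdot ξ ξ) * ‖η‖) := by simp [mul_assoc]

theorem abs_hessQ_le (f : (Fin n → ℝ) → (Fin N → Fin n → ℝ) → ℝ) (x : Fin n → ℝ)
    (ξ η : Fin N → Fin n → ℝ) :
    |hessQ f x ξ η| ≤
      N * n * N * n * (√(∑ i, ∑ j, ∑ k, ∑ l, hessc f x ξ i j k l ^ 2) * (‖η‖ * ‖η‖)) := by
  set S := √(∑ i, ∑ j, ∑ k, ∑ l, hessc f x ξ i j k l ^ 2) with hS
  have hη : ∀ i j, |η i j| ≤ ‖η‖ := fun i j =>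
    (norm_le_pi_norm (η i) j).trans (norm_le_pi_norm η i)
  have hc : ∀ i j k l, |hessc f x ξ i j k l| ≤ S := fun i j k l => by
    refine Real.abs_le_sqrt ?_
    calc hessc f x ξ i j k l ^ 2 ≤ ∑ l, hessc f x ξ i j k l ^ 2 :=
          Finset.single_le_sum (f := fun l => hessc f x ξ i j k l ^ 2)
            (fun _ _ => by positivity) (Finset.mem_univ l)
      _ ≤ ∑ k, ∑ l, hessc f x ξ i j k l ^ 2 :=
          Finset.single_le_sum (f := fun k => ∑ l, hessc f x ξ i j k l ^ 2)
            (fun _ _ => by positivity) (Finset.mem_univ k)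
      _ ≤ ∑ j, ∑ k, ∑ l, hessc f x ξ i j k l ^ 2 :=
          Finset.single_le_sum (f := fun j => ∑ k, ∑ l, hessc f x ξ i j k l ^ 2)
            (fun _ _ => by positivity) (Finset.mem_univ j)
      _ ≤ ∑ i, ∑ j, ∑ k, ∑ l, hessc f x ξ i j k l ^ 2 :=
          Finset.single_le_sum (f := fun i => ∑ j, ∑ k, ∑ l, hessc f x ξ i j k l ^ 2)
            (fun _ _ => by positivity) (Finset.mem_univ i)
  have key : ∀ i j k l, |hessc f x ξ i j k l * η i j * η k l| ≤ S * (‖η‖ * ‖η‖) :=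
    fun i j k l => by
      rw [mul_assoc, abs_mul, abs_mul]
      exact mul_le_mul (hc i j k l) (mul_le_mul (hη i j) (hη k l) (abs_nonneg _) (norm_nonneg _))
        (by positivity) (Real.sqrt_nonneg _)
  calc |hessQ f x ξ η| ≤ ∑ i, ∑ j, ∑ k, ∑ l, |hessc f x ξ i j k l * η i j * η k l| :=
        (Finset.abs_sum_le_sum_abs _ _).trans <| Finset.sum_le_sum fun i _ =>
        (Finset.abs_sum_le_sum_abs _ _).trans <| Finset.sum_le_sum fun j _ =>
        (Finset.abs_sum_le_sum_abs _ _).trans <| Finset.sum_le_sum fun k _ =>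
          Finset.abs_sum_le_sum_abs _ _
    _ ≤ ∑ _i : Fin N, ∑ _j : Fin n, ∑ _k : Fin N, ∑ _l : Fin n, S * (‖η‖ * ‖η‖) :=
        Finset.sum_le_sum fun i _ => Finset.sum_le_sum fun j _ =>
          Finset.sum_le_sum fun k _ => Finset.sum_le_sum fun l _ => key i j k l
    _ = N * n * N * n * (S * (‖η‖ * ‖η‖)) := by simp; ring

end Algebra

section Smooth

variable {n N : ℕ} {f : (Fin n → ℝ) → (Fin N → Fin n → ℝ) → ℝ} {x : Fin n → ℝ}

theorem contDiff_fderiv_apply_const (h : ContDiff ℝ 2 (f x)) (η : Fin N → Fin n → ℝ) :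
    ContDiff ℝ 1 fun ζ => fderiv ℝ (f x) ζ η :=
  (h.fderiv_right (m := 1) (by norm_num)).clm_apply contDiff_const

theorem hessQ_eq_fderiv (h : ContDiff ℝ 2 (f x)) (ξ η : Fin N → Fin n → ℝ) :
    hessQ f x ξ η = fderiv ℝ (fun ζ => fderiv ℝ (f x) ζ η) ξ η := by
  have hd : ∀ θ : Fin N → Fin n → ℝ,
      DifferentiableAt ℝ (fun ζ => fderiv ℝ (f x) ζ θ) ξ := fun θ =>
    (contDiff_fderiv_apply_const h θ).differentiable one_ne_zero ξ
  have hη : (fun ζ => fderiv ℝ (f x) ζ η) =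
      fun ζ => ∑ k, ∑ l, fderiv ℝ (f x) ζ (eMat k l) * η k l := by
    funext ζ; exact map_eq_sum_eMat _ _
  have hdir : ∀ i j, fderiv ℝ (fun ζ => fderiv ℝ (f x) ζ η) ξ (eMat i j) =
      ∑ k, ∑ l, hessc f x ξ i j k l * η k l := fun i j => by
    have : HasFDerivAt (fun ζ => ∑ k, ∑ l, fderiv ℝ (f x) ζ (eMat k l) * η k l)
        (∑ k, ∑ l, η k l • fderiv ℝ (fun ζ => fderiv ℝ (f x) ζ (eMat k l)) ξ) ξ :=
      HasFDerivAt.fun_sum fun k _ => HasFDerivAt.fun_sum fun l _ =>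
        (hd (eMat k l)).hasFDerivAt.mul_const (η k l)
    rw [hη, this.fderiv]
    simp [hessc, mul_comm]
  rw [map_eq_sum_eMat]
  simp only [hdir, hessQ, Finset.sum_mul]
  exact Finset.sum_congr rfl fun i _ => Finset.sum_congr rfl fun j _ =>
    Finset.sum_congr rfl fun k _ => Finset.sum_congr rfl fun l _ => by ring

theorem hasDerivAt_add_smul (ξ η : Fin N → Fin n → ℝ) (t : ℝ) :
    HasDerivAt (fun s : ℝ => ξ + s • η) η t := by
  simpa using ((hasDerivAt_id t).smul_const η).const_add ξ

theorem hasDerivAt_apply_add_smul (h : ContDiff ℝ 2 (f x)) (ξ η : Fin N → Fin n → ℝ) (t : ℝ) :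
    HasDerivAt (fun s : ℝ => f x (ξ + s • η)) (mdot (gradx f x (ξ + t • η)) η) t := by
  rw [mdot_gradx]
  exact (h.differentiable two_ne_zero _).hasFDerivAt.comp_hasDerivAt t (hasDerivAt_add_smul ξ η t)

theorem hasDerivAt_mdot_gradx (h : ContDiff ℝ 2 (f x)) (ξ η : Fin N → Fin n → ℝ) (t : ℝ) :
    HasDerivAt (fun s : ℝ => mdot (gradx f x (ξ + s • η)) η) (hessQ f x (ξ + t • η) η) t := by
  rw [hessQ_eq_fderiv h]
  simp only [mdot_gradx]
  exact ((contDiff_fderiv_apply_const h η).differentiable one_ne_zero _).hasFDerivAt.comp_hasDerivAt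
    t (hasDerivAt_add_smul ξ η t)

theorem norm_hess_le_iSup (h : ContDiff ℝ 2 (f x)) {K : Set (Fin N → Fin n → ℝ)}
    (hK : IsCompact K) {ξ : Fin N → Fin n → ℝ} (hξ : ξ ∈ K) :
    √(∑ i, ∑ j, ∑ k, ∑ l, hessc f x ξ i j k l ^ 2) ≤
      ⨆ ζ ∈ K, √(∑ i, ∑ j, ∑ k, ∑ l, hessc f x ζ i j k l ^ 2) := by
  have hc : ∀ i j k l, Continuous fun ζ => hessc f x ζ i j k l := fun i j k l =>
    ((contDiff_fderiv_apply_const h (eMat k l)).continuous_fderiv one_ne_zero).clm_apply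
      continuous_const
  have hcont : Continuous fun ζ => √(∑ i, ∑ j, ∑ k, ∑ l, hessc f x ζ i j k l ^ 2) := by
    fun_prop
  obtain ⟨B, hB⟩ := hK.bddAbove_image hcont.continuousOn
  have hB' : ∀ ζ ∈ K, √(∑ i, ∑ j, ∑ k, ∑ l, hessc f x ζ i j k l ^ 2) ≤ B := fun ζ hζ =>
    hB (Set.mem_image_of_mem _ hζ)
  have hB0 : 0 ≤ B := (Real.sqrt_nonneg _).trans (hB' ξ hξ)
  refine le_ciSup_of_le ⟨B, ?_⟩ ξ ?_
  · rintro _ ⟨ζ, rfl⟩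
    exact Real.iSup_le (fun hζ => hB' ζ hζ) hB0
  · rw [ciSup_pos hξ]

end Smooth

section Measurability

theorem aestronglyMeasurable_of_hasDerivAt {α : Type*} [MeasurableSpace α] {μ : Measure α}
    {F : ℝ → α → ℝ} {F' : α → ℝ} {t : ℝ} (hF : ∀ s, AEStronglyMeasurable (F s) μ)
    (h : ∀ᵐ x ∂μ, HasDerivAt (fun s => F s x) (F' x) t) : AEStronglyMeasurable F' μ := by
  refine aestronglyMeasurable_of_tendsto_ae (nhdsWithin (0 : ℝ) (Set.Ioi 0))
    (f := fun s x => s⁻¹ • (F (t + s) x - F t x))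
    (fun s => ((hF (t + s)).sub (hF t)).const_smul s⁻¹) ?_
  filter_upwards [h] with x hx using hx.tendsto_slope_zero_right

theorem aestronglyMeasurable_comp_of_ae_continuous {α E : Type*} [MeasurableSpace α]
    {μ : Measure α} [TopologicalSpace E] {f : α → E → ℝ} {u : α → E}
    (hf : ∀ ξ, Measurable fun x => f x ξ) (hc : ∀ᵐ x ∂μ, Continuous (f x))
    (hu : StronglyMeasurable u) : AEStronglyMeasurable (fun x => f x (u x)) μ := by
  refine aestronglyMeasurable_of_tendsto_ae Filter.atTop
    (f := fun k x => f x (hu.approx k x))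
    (fun k => (SimpleFunc.measurable_bind (hu.approx k) (fun ξ x => f x ξ)
      hf).aestronglyMeasurable) ?_
  filter_upwards [hc] with x hx using (hx.tendsto _).comp (hu.tendsto_approx x)

end Measurability

section TestMaps

variable {n N : ℕ} {Ω : Set (Fin n → ℝ)} {φ ψ : (Fin n → ℝ) → Fin N → ℝ}

theorem TestMap.add_smul (hψ : TestMap Ω ψ) (hφ : TestMap Ω φ) (t : ℝ) :
    TestMap Ω (fun x => ψ x + t • φ x) := by
  have hs : tsupport (fun x => t • φ x) ⊆ tsupport φ :=
    tsupport_smul_subset_right (fun _ => t) φ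
  refine ⟨hψ.1.add (hφ.1.const_smul t), ?_, ?_⟩
  · exact hψ.2.1.add (hφ.2.1.mono' (subset_closure.trans hs))
  · exact (tsupport_add _ _).trans (Set.union_subset hψ.2.2 (hs.trans hφ.2.2))

theorem TestMap.smul (hφ : TestMap Ω φ) (t : ℝ) : TestMap Ω (fun x => t • φ x) := by
  have hs : tsupport (fun x => t • φ x) ⊆ tsupport φ :=
    tsupport_smul_subset_right (fun _ => t) φ
  exact ⟨hφ.1.const_smul t, hφ.2.1.mono' (subset_closure.trans hs), hs.trans hφ.2.2⟩

theorem TestMap.differentiable (hφ : TestMap Ω φ) : Differentiable ℝ φ :=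
  hφ.1.differentiable (by simp)

theorem jac_smul (hφ : TestMap Ω φ) (t : ℝ) (x : Fin n → ℝ) :
    jac (fun x => t • φ x) x = t • jac φ x := by
  ext i j
  simp only [jac]
  rw [fderiv_fun_const_smul (hφ.differentiable x)]
  rfl

theorem jac_add_smul (hψ : TestMap Ω ψ) (hφ : TestMap Ω φ) (t : ℝ) (x : Fin n → ℝ) :
    jac (fun x => ψ x + t • φ x) x = jac ψ x + t • jac φ x := by
  rw [← jac_smul hφ]
  ext i j
  simp only [jac]
  rw [fderiv_fun_add (hψ.differentiable x) ((hφ.smul t).differentiable x)]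
  rfl

theorem TestMap.continuous_jac (hφ : TestMap Ω φ) : Continuous (jac φ) := by
  have := hφ.1.continuous_fderiv (by simp)
  refine continuous_pi fun i => continuous_pi fun j => ?_
  exact (continuous_apply i).comp (this.clm_apply continuous_const)

theorem TestMap.exists_norm_jac_le (hφ : TestMap Ω φ) : ∃ C, ∀ x, ‖jac φ x‖ ≤ C := by
  refine hφ.continuous_jac.bounded_above_of_compact_support ?_
  exact (hφ.2.1.fderiv ℝ).comp_left
    (g := fun A : (Fin n → ℝ) →L[ℝ] (Fin N → ℝ) => fun i j => A (Pi.single j 1) i) rfl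

end TestMaps

section Variation

variable {n N : ℕ} {Ω : Set (Fin n → ℝ)} {f : (Fin n → ℝ) → (Fin N → Fin n → ℝ) → ℝ}
  {φ ψ : (Fin n → ℝ) → Fin N → ℝ}

theorem aestronglyMeasurable_mdot_gradx
    (hmeas : ∀ ξ : Fin N → Fin n → ℝ, Measurable fun x => f x ξ)
    (hC2 : ∀ᵐ x ∂(volume.restrict Ω), ContDiff ℝ 2 (f x))
    (hφ : TestMap Ω φ) (hψ : TestMap Ω ψ) (t : ℝ) :
    AEStronglyMeasurable (fun x => mdot (gradx f x (jac ψ x + t • jac φ x)) (jac φ x))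
      (volume.restrict Ω) := by
  refine aestronglyMeasurable_of_hasDerivAt (F := fun s x => f x (jac ψ x + s • jac φ x)) (t := t)
    (fun s => aestronglyMeasurable_comp_of_ae_continuous hmeas
      (hC2.mono fun x hx => hx.continuous)
      (hψ.continuous_jac.add (hφ.continuous_jac.const_smul s)).stronglyMeasurable) ?_
  filter_upwards [hC2] with x hx using hasDerivAt_apply_add_smul hx _ _ _

theorem integrable_mdot_gradx (hΩb : Bornology.IsBounded Ω)
    (hmeas : ∀ ξ : Fin N → Fin n → ℝ, Measurable fun x => f x ξ)
    (hC2 : ∀ᵐ x ∂(volume.restrict Ω), ContDiff ℝ 2 (f x))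
    {c₂ : (Fin n → ℝ) → ℝ} {c₃ : (Fin N → Fin n → ℝ) → ℝ}
    (hc₂int : IntegrableOn c₂ Ω) (hc₃cont : Continuous c₃)
    (hgrowth : ∀ᵐ x ∂(volume.restrict Ω), ∀ ξ : Fin N → Fin n → ℝ,
      √(mdot (gradx f x ξ) (gradx f x ξ)) ≤ c₂ x + c₃ ξ)
    (hφ : TestMap Ω φ) (hψ : TestMap Ω ψ) (t : ℝ) :
    IntegrableOn (fun x => mdot (gradx f x (jac ψ x + t • jac φ x)) (jac φ x)) Ω := by
  obtain ⟨M, hM⟩ := hφ.exists_norm_jac_le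
  obtain ⟨M', hM'⟩ := (hψ.add_smul hφ t).exists_norm_jac_le
  simp only [jac_add_smul hψ hφ] at hM'
  obtain ⟨B, hB⟩ := (isCompact_closedBall (0 : Fin N → Fin n → ℝ) M').bddAbove_image
    hc₃cont.continuousOn
  have hfin : volume Ω ≠ ⊤ := hΩb.measure_lt_top.ne
  have hbound : IntegrableOn (fun x => N * n * ((c₂ x + B) * M)) Ω :=
    ((hc₂int.add (integrableOn_const hfin)).mul_const M).const_mul (N * n : ℝ)
  refine Integrable.mono' hbound (aestronglyMeasurable_mdot_gradx hmeas hC2 hφ hψ t) ?_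
  filter_upwards [hgrowth] with x hx
  have h3 : c₃ (jac ψ x + t • jac φ x) ≤ B :=
    hB (Set.mem_image_of_mem _ (mem_closedBall_zero_iff.2 (hM' x)))
  have h2 : √(mdot (gradx f x (jac ψ x + t • jac φ x)) (gradx f x (jac ψ x + t • jac φ x)))
      ≤ c₂ x + B := (hx _).trans (by linarith)
  refine (abs_mdot_le _ _).trans (mul_le_mul_of_nonneg_left ?_ (by positivity))
  exact mul_le_mul h2 (hM x) (norm_nonneg _) ((Real.sqrt_nonneg _).trans h2)

theorem hasDerivAt_integral_mdot_gradx (hΩb : Bornology.IsBounded Ω)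
    (hmeas : ∀ ξ : Fin N → Fin n → ℝ, Measurable fun x => f x ξ)
    (hC2 : ∀ᵐ x ∂(volume.restrict Ω), ContDiff ℝ 2 (f x))
    {c₂ : (Fin n → ℝ) → ℝ} {c₃ : (Fin N → Fin n → ℝ) → ℝ}
    (hc₂int : IntegrableOn c₂ Ω) (hc₃cont : Continuous c₃)
    (hgrowth : ∀ᵐ x ∂(volume.restrict Ω), ∀ ξ : Fin N → Fin n → ℝ,
      √(mdot (gradx f x ξ) (gradx f x ξ)) ≤ c₂ x + c₃ ξ)
    (hhess : ∀ K : Set (Fin N → Fin n → ℝ), IsCompact K →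
      IntegrableOn (fun x =>
        ⨆ ξ ∈ K, √(∑ i, ∑ j, ∑ k, ∑ l, hessc f x ξ i j k l ^ 2)) Ω)
    (hφ : TestMap Ω φ) (hψ : TestMap Ω ψ) (t : ℝ) :
    HasDerivAt
      (fun s : ℝ => ∫ x in Ω, mdot (gradx f x (jac ψ x + s • jac φ x)) (jac φ x))
      (∫ x in Ω, hessQ f x (jac ψ x + t • jac φ x) (jac φ x)) t := by
  obtain ⟨M, hM⟩ := hφ.exists_norm_jac_le
  obtain ⟨M', hM'⟩ := hψ.exists_norm_jac_le
  have hM0 : 0 ≤ M := (norm_nonneg _).trans (hM 0)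
  set K := Metric.closedBall (0 : Fin N → Fin n → ℝ) (M' + (|t| + 1) * M) with hKdef
  have hK : IsCompact K := isCompact_closedBall _ _
  have hmem : ∀ s ∈ Metric.ball t 1, ∀ x, jac ψ x + s • jac φ x ∈ K := fun s hs x => by
    have hs' : |s| ≤ |t| + 1 := by
      have h1 : |s - t| < 1 := by simpa [Real.dist_eq] using hs
      linarith [abs_sub_abs_le_abs_sub s t]
    rw [hKdef, mem_closedBall_zero_iff]
    refine (norm_add_le _ _).trans (add_le_add (hM' x) ?_)
    rw [norm_smul, Real.norm_eq_abs]
    exact mul_le_mul hs' (hM x) (norm_nonneg _) (by positivity)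
  refine (hasDerivAt_integral_of_dominated_loc_of_deriv_le
    (μ := volume.restrict Ω) (s := Metric.ball t 1)
    (bound := fun x => N * n * N * n *
      ((⨆ ξ ∈ K, √(∑ i, ∑ j, ∑ k, ∑ l, hessc f x ξ i j k l ^ 2)) * (M * M)))
    (F := fun s x => mdot (gradx f x (jac ψ x + s • jac φ x)) (jac φ x))
    (F' := fun s x => hessQ f x (jac ψ x + s • jac φ x) (jac φ x))
    (Metric.ball_mem_nhds t one_pos)
    (Filter.Eventually.of_forall fun s => aestronglyMeasurable_mdot_gradx hmeas hC2 hφ hψ s)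
    (integrable_mdot_gradx hΩb hmeas hC2 hc₂int hc₃cont hgrowth hφ hψ t)
    (aestronglyMeasurable_of_hasDerivAt (t := t)
      (fun s => aestronglyMeasurable_mdot_gradx hmeas hC2 hφ hψ s) ?_)
    ?_ (((hhess K hK).mul_const (M * M)).const_mul (N * n * N * n : ℝ)) ?_).2
  · filter_upwards [hC2] with x hx using hasDerivAt_mdot_gradx hx _ _ _
  · filter_upwards [hC2] with x hx s hs
    refine (abs_hessQ_le _ _ _ _).trans (mul_le_mul_of_nonneg_left ?_ (by positivity))
    have hle := norm_hess_le_iSup hx hK (hmem s hs x)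
    exact mul_le_mul hle (mul_self_le_mul_self (norm_nonneg _) (hM x)) (by positivity)
      ((Real.sqrt_nonneg _).trans hle)
  · filter_upwards [hC2] with x hx s _ using hasDerivAt_mdot_gradx hx _ _ _

end Variation

/-- Under the stated measurability, `C²` smoothness in `ξ`, growth of
`D_ξ f`, and local integrability of the Hessian, integral monotonicity of `D_ξ f`
(condition (a)) is equivalent to nonnegativity of the second variation (condition (b)). -/
theorem integral_monotone_iff_second_variation_nonneg
    {N n : ℕ} (hN : 0 < N) (hn : 0 < n)
    (Ω : Set (Fin n → ℝ)) (hΩo : IsOpen Ω) (hΩne : Ω.Nonempty)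
    (hΩb : Bornology.IsBounded Ω)
    (f : (Fin n → ℝ) → (Fin N → Fin n → ℝ) → ℝ)
    (hmeas : ∀ ξ : Fin N → Fin n → ℝ, Measurable fun x => f x ξ)
    (hC2 : ∀ᵐ x ∂(volume.restrict Ω), ContDiff ℝ 2 (f x))
    (c₂ : (Fin n → ℝ) → ℝ) (c₃ : (Fin N → Fin n → ℝ) → ℝ)
    (hc₂0 : ∀ x, 0 ≤ c₂ x) (hc₂int : IntegrableOn c₂ Ω)
    (hc₃0 : ∀ ξ, 0 ≤ c₃ ξ) (hc₃cont : Continuous c₃)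
    (hgrowth : ∀ᵐ x ∂(volume.restrict Ω), ∀ ξ : Fin N → Fin n → ℝ,
      Real.sqrt (mdot (gradx f x ξ) (gradx f x ξ)) ≤ c₂ x + c₃ ξ)
    (hhess : ∀ K : Set (Fin N → Fin n → ℝ), IsCompact K →
      IntegrableOn (fun x =>
        ⨆ ξ ∈ K, Real.sqrt (∑ i, ∑ j, ∑ k, ∑ l, hessc f x ξ i j k l ^ 2)) Ω) :
    (∀ φ ψ : (Fin n → ℝ) → Fin N → ℝ, TestMap Ω φ → TestMap Ω ψ →
      0 ≤ ∫ x in Ω,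
        mdot (gradx f x (jac ψ x + jac φ x) - gradx f x (jac ψ x)) (jac φ x)) ↔
    (∀ φ ψ : (Fin n → ℝ) → Fin N → ℝ, TestMap Ω φ → TestMap Ω ψ →
      0 ≤ ∫ x in Ω, hessQ f x (jac ψ x) (jac φ x)) := by
  have hderiv := fun (φ ψ : (Fin n → ℝ) → Fin N → ℝ) (hφ : TestMap Ω φ) (hψ : TestMap Ω ψ) =>
    hasDerivAt_integral_mdot_gradx hΩb hmeas hC2 hc₂int hc₃cont hgrowth hhess hφ hψ
  have hint := fun (φ ψ : (Fin n → ℝ) → Fin N → ℝ) (hφ : TestMap Ω φ) (hψ : TestMap Ω ψ) =>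
    integrable_mdot_gradx hΩb hmeas hC2 hc₂int hc₃cont hgrowth hφ hψ
  constructor
  · intro ha φ ψ hφ hψ
    have hmono : Monotone fun s : ℝ =>
        ∫ x in Ω, mdot (gradx f x (jac ψ x + s • jac φ x)) (jac φ x) := fun s t hst => by
      rcases hst.eq_or_lt with rfl | hlt
      · exact le_rfl
      have h := ha _ _ (hφ.smul (t - s)) (hψ.add_smul hφ s)
      have hadd : ∀ x, jac ψ x + s • jac φ x + (t - s) • jac φ x = jac ψ x + t • jac φ x :=
        fun x => by module
      simp only [jac_smul hφ, jac_add_smul hψ hφ, hadd, mdot_smul_right, mdot_sub_left] at h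
      rw [integral_const_mul, integral_sub (hint φ ψ hφ hψ t) (hint φ ψ hφ hψ s)] at h
      exact sub_nonneg.1 (nonneg_of_mul_nonneg_right h (sub_pos.2 hlt))
    have h0 := hderiv φ ψ hφ hψ 0
    have := hmono.deriv_nonneg (x := 0)
    rw [h0.deriv] at this
    simpa using this
  · intro hb φ ψ hφ hψ
    have hmono := monotone_of_deriv_nonneg
      (fun t => (hderiv φ ψ hφ hψ t).differentiableAt) fun t => by
        have h := hb _ _ hφ (hψ.add_smul hφ t)
        simp only [jac_add_smul hψ hφ] at h
        rwa [(hderiv φ ψ hφ hψ t).deriv]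
    have h := sub_nonneg.2 (hmono zero_le_one)
    rw [← integral_sub (hint φ ψ hφ hψ 1) (hint φ ψ hφ hψ 0)] at h
    simpa [mdot_sub_left] using h
end

section
/- For every k with −2 ≤ k ≤ 4, the function g_k(ξ) := |ξ|⁴ + k (det ξ)² is convex on the space ℝ^{2×2} of real 2×2 matrices. -/
/-- The determinant of a `2×2` matrix (modeled as `Fin 2 → Fin 2 → ℝ`). -/
def det2 (ξ : Fin 2 → Fin 2 → ℝ) : ℝ := ξ 0 0 * ξ 1 1 - ξ 0 1 * ξ 1 0

/-- The squared Frobenius norm `|ξ|²` of a `2×2` matrix. -/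
def nsq (ξ : Fin 2 → Fin 2 → ℝ) : ℝ := ∑ i, ∑ j, ξ i j ^ 2

/-- The profile of `g_k` in terms of the norms `s`, `t` of the conformal and anticonformal parts is
convex in `(s, t)`. -/
lemma convex_profile {α β : ℝ} (hα : 0 ≤ α) (hβ : 0 ≤ β) {u v : ℝ} (hu : 0 ≤ u) (hv : 0 ≤ v)
    (huv : u + v = 1) (s₁ t₁ s₂ t₂ : ℝ) :
    α * ((u * s₁ + v * s₂) ^ 4 + (u * t₁ + v * t₂) ^ 4) +
        β * (2 * (u * s₁ + v * s₂) ^ 4 + 12 * (u * s₁ + v * s₂) ^ 2 * (u * t₁ + v * t₂) ^ 2 +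
          2 * (u * t₁ + v * t₂) ^ 4) ≤
      u * (α * (s₁ ^ 4 + t₁ ^ 4) + β * (2 * s₁ ^ 4 + 12 * s₁ ^ 2 * t₁ ^ 2 + 2 * t₁ ^ 4)) +
      v * (α * (s₂ ^ 4 + t₂ ^ 4) + β * (2 * s₂ ^ 4 + 12 * s₂ ^ 2 * t₂ ^ 2 + 2 * t₂ ^ 4)) := by
  have key (x y : ℝ) : (u * x + v * y) ^ 4 ≤ u * x ^ 4 + v * y ^ 4 := by
    simpa using (Even.convexOn_pow (𝕜 := ℝ) (n := 4) (by decide)).2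
      (Set.mem_univ x) (Set.mem_univ y) hu hv huv
  linear_combination α * key s₁ s₂ + α * key t₁ t₂ +
    β * key (s₁ + t₁) (s₂ + t₂) + β * key (s₁ - t₁) (s₂ - t₂)

/-- The conformal part of a `2×2` matrix, as a complex number. -/
def conformalPart (ξ : Fin 2 → Fin 2 → ℝ) : ℂ := ⟨ξ 0 0 + ξ 1 1, ξ 0 1 - ξ 1 0⟩

/-- The anticonformal part of a `2×2` matrix, as a complex number. -/
def anticonformalPart (ξ : Fin 2 → Fin 2 → ℝ) : ℂ := ⟨ξ 0 0 - ξ 1 1, ξ 0 1 + ξ 1 0⟩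

lemma norm_combo_le {u v : ℝ} (hu : 0 ≤ u) (hv : 0 ≤ v) (z w : ℂ) :
    ‖u • z + v • w‖ ≤ u * ‖z‖ + v * ‖w‖ := by
  refine (norm_add_le _ _).trans_eq ?_
  rw [norm_smul, norm_smul, Real.norm_of_nonneg hu, Real.norm_of_nonneg hv]

lemma nsq_sq_add_mul_det2_sq (k : ℝ) (ξ : Fin 2 → Fin 2 → ℝ) :
    nsq ξ ^ 2 + k * det2 ξ ^ 2 =
      (2 + k) / 12 * (‖conformalPart ξ‖ ^ 4 + ‖anticonformalPart ξ‖ ^ 4) +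
      (4 - k) / 96 * (2 * ‖conformalPart ξ‖ ^ 4 +
        12 * ‖conformalPart ξ‖ ^ 2 * ‖anticonformalPart ξ‖ ^ 2 +
        2 * ‖anticonformalPart ξ‖ ^ 4) := by
  have h4 (z : ℂ) : ‖z‖ ^ 4 = (‖z‖ ^ 2) ^ 2 := by ring
  simp only [h4, Complex.sq_norm, Complex.normSq_apply, conformalPart, anticonformalPart, nsq,
    det2, Fin.sum_univ_two]
  ring

/-- For every `−2 ≤ k ≤ 4` the function
`g_k(ξ) = |ξ|⁴ + k (det ξ)²` is convex on `ℝ^{2×2}`. -/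
theorem gk_convex_of_k_mem_Icc (k : ℝ) (hk1 : -2 ≤ k) (hk2 : k ≤ 4) :
    ConvexOn ℝ Set.univ
      (fun ξ : Fin 2 → Fin 2 → ℝ => nsq ξ ^ 2 + k * det2 ξ ^ 2) := by
  have hα : 0 ≤ (2 + k) / 12 := by linarith
  have hβ : 0 ≤ (4 - k) / 96 := by linarith
  refine ⟨convex_univ, fun ξ _ η _ u v hu hv huv => ?_⟩
  have hs : conformalPart (u • ξ + v • η) = u • conformalPart ξ + v • conformalPart η := by
    apply Complex.ext <;> simp [conformalPart] <;> ring
  have ht : anticonformalPart (u • ξ + v • η) =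
      u • anticonformalPart ξ + v • anticonformalPart η := by
    apply Complex.ext <;> simp [anticonformalPart] <;> ring
  simp only [nsq_sq_add_mul_det2_sq, smul_eq_mul, hs, ht]
  refine le_trans ?_ (convex_profile hα hβ hu hv huv _ _ _ _)
  gcongr <;> exact norm_combo_le hu hv _ _
end

section
/- Strong quasimonotonicity of Dg_k for 0 ≤ k ≤ 8: let Ω ⊂ ℝ² be a nonempty bounded open set and let 0 ≤ k ≤ 8. Then for every ξ ∈ ℝ^{2×2} and every φ ∈ C_c^∞(Ω;ℝ²), ∫_Ω Dg_k(ξ + Dφ(x)) : Dφ(x) dx ≥ ((8 − k)/8) ∫_Ω |Dφ(x)|⁴ dx, where Dg_k(ζ) = 4|ζ|² ζ + 2k (det ζ) cof ζ is the gradient of g_k(ζ) = |ζ|⁴ + k (det ζ)². -/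
open MeasureTheory

/-- The cofactor matrix of a `2×2` matrix, so that `ξ : cof ξ = 2 det ξ`. -/
def cof2 (ξ : Fin 2 → Fin 2 → ℝ) : Fin 2 → Fin 2 → ℝ :=
  ![![ξ 1 1, -ξ 1 0], ![-ξ 0 1, ξ 0 0]]

/-- The Frobenius inner product `ξ : η`. -/
def mdot2 (ξ η : Fin 2 → Fin 2 → ℝ) : ℝ := ∑ i, ∑ j, ξ i j * η i j

/-- The gradient `Dg_k(ξ) = 4|ξ|²ξ + 2k (det ξ) cof ξ` of `g_k(ξ) = |ξ|⁴ + k (det ξ)²`. -/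
def Dg (k : ℝ) (ξ : Fin 2 → Fin 2 → ℝ) : Fin 2 → Fin 2 → ℝ :=
  fun i j => 4 * nsq ξ * ξ i j + 2 * k * det2 ξ * cof2 ξ i j

/-- The Jacobian matrix `Dφ(x) ∈ ℝ^{2×2}` of `φ : ℝ² → ℝ²` at `x`. -/
noncomputable def jac2 (φ : (Fin 2 → ℝ) → Fin 2 → ℝ) (x : Fin 2 → ℝ) :
    Fin 2 → Fin 2 → ℝ :=
  fun i j => fderiv ℝ φ x (Pi.single j 1) i

/-- Pointwise lower bound for `Dg k (ξ + η) : η` by null Lagrangians in `η` and `|η|⁴`. -/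
lemma le_mdot2_Dg_add {k : ℝ} (hk0 : 0 ≤ k) (hk8 : k ≤ 8) (ξ η : Fin 2 → Fin 2 → ℝ) :
    (8 - k) / 8 * nsq η ^ 2 + (mdot2 (Dg k ξ) η + 2 * k * det2 ξ * det2 η) ≤
      mdot2 (Dg k (ξ + η)) η := by
  simp only [mdot2, Dg, nsq, det2, cof2, Fin.sum_univ_two, Pi.add_apply, Matrix.cons_val_zero,
    Matrix.cons_val_one]
  generalize ξ 0 0 = a, ξ 0 1 = b, ξ 1 0 = c, ξ 1 1 = d
  generalize η 0 0 = x, η 0 1 = y, η 1 0 = z, η 1 1 = w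
  set n := x ^ 2 + y ^ 2 + (z ^ 2 + w ^ 2) with hn
  set p := a * x + b * y + (c * z + d * w) with hp
  set q := a * w + d * x - b * z - c * y with hq
  set e := x * w - y * z with he
  have h₀ : 0 ≤ 3 * (n + 2 * p) ^ 2 + 4 * ((a * y - b * x) ^ 2 + (a * z - c * x) ^ 2 +
      (a * w - d * x) ^ 2 + (b * z - c * y) ^ 2 + (b * w - d * y) ^ 2 + (c * w - d * z) ^ 2) := by
    positivity
  have h₈ : 0 ≤ (2 * n + 3 * p) ^ 2 + 3 * p ^ 2 + 2 * (4 * e + 3 * q) ^ 2 + 2 * q ^ 2 +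
      2 * (((a + d) * (z - y) - (c - b) * (x + w)) ^ 2 +
        ((a - d) * (z + y) - (c + b) * (x - w)) ^ 2) := by
    positivity
  have h := add_nonneg (mul_nonneg (sub_nonneg.2 hk8) h₀) (mul_nonneg hk0 h₈)
  rw [hn, hp, hq, he] at h
  rw [hn, he]
  linear_combination h / 8

section IntegrationByParts

variable {E : Type*} [NormedAddCommGroup E] [NormedSpace ℝ E] [FiniteDimensional ℝ E]
  [MeasurableSpace E] [BorelSpace E] (μ : Measure E) [μ.IsAddHaarMeasure]

/-- A directional derivative of a compactly supported `C¹` function has zero integral. -/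
lemma integral_fderiv_apply_eq_zero {f : E → ℝ} (hf : ContDiff ℝ 1 f) (hfs : HasCompactSupport f)
    (v : E) : ∫ x, fderiv ℝ f x v ∂μ = 0 := by
  have hint : Integrable (fun x ↦ fderiv ℝ f x v) μ :=
    ((hf.continuous_fderiv one_ne_zero).clm_apply
      continuous_const).integrable_of_hasCompactSupport (hfs.fderiv_apply ℝ v)
  have h := integral_mul_fderiv_eq_neg_fderiv_mul_of_integrable (μ := μ) (𝕜 := ℝ)
    (f := fun _ ↦ 1) (g := f) (v := v) (by simp) (by simpa using hint)
    (by simpa using hf.continuous.integrable_of_hasCompactSupport hfs)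
    (fun x _ ↦ differentiableAt_const _) (fun x _ ↦ hf.differentiable one_ne_zero x)
  simpa using h

/-- The `2×2` minors of the gradient are null Lagrangians. -/
lemma integral_fderiv_mul_fderiv_comm {f g : E → ℝ} (hf : ContDiff ℝ 1 f)
    (hfs : HasCompactSupport f) (hg : ContDiff ℝ 2 g) (v w : E) :
    ∫ x, fderiv ℝ f x v * fderiv ℝ g x w ∂μ = ∫ x, fderiv ℝ f x w * fderiv ℝ g x v ∂μ := by
  have hdg : ContDiff ℝ 1 (fderiv ℝ g) := hg.fderiv_right (by norm_num)
  have hd : ∀ u, ContDiff ℝ 1 (fun x ↦ fderiv ℝ g x u) := fun u ↦ hdg.clm_apply contDiff_const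
  have hcf : ∀ u, Continuous (fun x ↦ fderiv ℝ f x u) := fun u ↦
    (hf.continuous_fderiv one_ne_zero).clm_apply continuous_const
  have key : ∀ u u', ∫ x, fderiv ℝ f x u * fderiv ℝ g x u' ∂μ =
      -∫ x, f x * fderiv ℝ (fderiv ℝ g) x u u' ∂μ := by
    intro u u'
    have hsnd : ∀ x, fderiv ℝ (fun y ↦ fderiv ℝ g y u') x u = fderiv ℝ (fderiv ℝ g) x u u' := by
      intro x
      rw [fderiv_clm_apply (hdg.differentiable one_ne_zero x) (differentiableAt_const _)]
      simp
    have h := integral_mul_fderiv_eq_neg_fderiv_mul_of_integrable (μ := μ) (𝕜 := ℝ)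
      (f := f) (g := fun x ↦ fderiv ℝ g x u') (v := u)
      (((hcf u).mul (hd u').continuous).integrable_of_hasCompactSupport
        (hfs.fderiv_apply ℝ u).mul_right)
      ((hf.continuous.mul (((hd u').continuous_fderiv one_ne_zero).clm_apply
        continuous_const)).integrable_of_hasCompactSupport hfs.mul_right)
      ((hf.continuous.mul (hd u').continuous).integrable_of_hasCompactSupport hfs.mul_right)
      (fun x _ ↦ hf.differentiable one_ne_zero x) (fun x _ ↦ (hd u').differentiable one_ne_zero x)
    simp only [hsnd] at h
    rw [h, neg_neg]
  rw [key, key]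
  congr 2 with x
  rw [(hg.contDiffAt.isSymmSndFDerivAt (by simp)).eq v w]

end IntegrationByParts

/-- Strong quasimonotonicity of `Dg_k` for `0 ≤ k ≤ 8`: for every
nonempty bounded open `Ω ⊂ ℝ²`, every `ξ ∈ ℝ^{2×2}` and every `φ ∈ C_c^∞(Ω;ℝ²)`,
`∫_Ω Dg_k(ξ + Dφ) : Dφ dx ≥ ((8 − k)/8) ∫_Ω |Dφ|⁴ dx`. -/
theorem Dg_strongly_quasimonotone
    (Ω : Set (Fin 2 → ℝ)) (hΩo : IsOpen Ω) (hΩne : Ω.Nonempty)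
    (hΩb : Bornology.IsBounded Ω)
    (k : ℝ) (hk0 : 0 ≤ k) (hk8 : k ≤ 8)
    (ξ : Fin 2 → Fin 2 → ℝ) (φ : (Fin 2 → ℝ) → Fin 2 → ℝ)
    (hφ : ContDiff ℝ (⊤ : ℕ∞) φ) (hφs : HasCompactSupport φ) (hφΩ : tsupport φ ⊆ Ω) :
    (8 - k) / 8 * ∫ x in Ω, nsq (jac2 φ x) ^ 2 ≤
      ∫ x in Ω, mdot2 (Dg k (ξ + jac2 φ x)) (jac2 φ x) := by
  have hφ2 : ∀ i, ContDiff ℝ 2 (fun x ↦ φ x i) := fun i ↦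
    (contDiff_pi.1 hφ i).of_le (WithTop.coe_le_coe.2 (le_top : (2 : ℕ∞) ≤ ⊤))
  have hφ1 : ∀ i, ContDiff ℝ 1 (fun x ↦ φ x i) := fun i ↦ (hφ2 i).of_le one_le_two
  have hs : ∀ i, HasCompactSupport (fun x ↦ φ x i) := fun i ↦
    hφs.comp_left (g := fun y : Fin 2 → ℝ ↦ y i) rfl
  have hφd : Differentiable ℝ φ := hφ.differentiable (by simp)
  have hjac : ∀ x i j, jac2 φ x i j = fderiv ℝ (fun y ↦ φ y i) x (Pi.single j 1) := by
    intro x i j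
    rw [fderiv_apply (hφd x)]
    rfl
  have hjc : ∀ i j, Continuous (fun x ↦ jac2 φ x i j) := by
    intro i j
    simp only [hjac]
    exact ((hφ1 i).continuous_fderiv one_ne_zero).clm_apply continuous_const
  have hj0 : ∀ x, x ∉ tsupport φ → jac2 φ x = 0 := by
    intro x hx
    have h0 : fderiv ℝ φ x = 0 := by
      by_contra h
      exact hx (support_fderiv_subset ℝ h)
    ext i j
    simp [jac2, h0]
  have hint : ∀ F : (Fin 2 → Fin 2 → ℝ) → ℝ, Continuous F → F 0 = 0 →
      Integrable (fun x ↦ F (jac2 φ x)) := by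
    intro F hF hF0
    refine Continuous.integrable_of_hasCompactSupport
      (hF.comp (continuous_pi fun i ↦ continuous_pi fun j ↦ hjc i j)) ?_
    exact HasCompactSupport.intro hφs fun x hx ↦ by rw [hj0 x hx, hF0]
  have hset : ∀ F : (Fin 2 → Fin 2 → ℝ) → ℝ, F 0 = 0 →
      ∫ x in Ω, F (jac2 φ x) = ∫ x, F (jac2 φ x) := fun F hF0 ↦
    setIntegral_eq_integral_of_forall_compl_eq_zero fun x hx ↦ by
      rw [hj0 x fun h ↦ hx (hφΩ h), hF0]
  have hij : ∀ i j, Integrable (fun x ↦ jac2 φ x i j) := fun i j ↦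
    hint (fun η ↦ η i j) (by fun_prop) rfl
  have hlin : ∀ A : Fin 2 → Fin 2 → ℝ, ∫ x, mdot2 A (jac2 φ x) = 0 := by
    intro A
    simp only [mdot2]
    rw [integral_finsetSum _ fun i _ ↦ integrable_finsetSum _ fun j _ ↦ (hij i j).const_mul _]
    refine Finset.sum_eq_zero fun i _ ↦ ?_
    rw [integral_finsetSum _ fun j _ ↦ (hij i j).const_mul _]
    refine Finset.sum_eq_zero fun j _ ↦ ?_
    simp only [integral_const_mul, hjac]
    rw [integral_fderiv_apply_eq_zero volume (hφ1 i) (hs i), mul_zero]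
  have hdet : ∫ x, det2 (jac2 φ x) = 0 := by
    simp only [det2]
    rw [integral_sub (hint (fun η ↦ η 0 0 * η 1 1) (by fun_prop) (by simp))
      (hint (fun η ↦ η 0 1 * η 1 0) (by fun_prop) (by simp)), sub_eq_zero]
    simp only [hjac]
    exact integral_fderiv_mul_fderiv_comm volume (hφ1 0) (hs 0) (hφ2 1) _ _
  have hnsq0 : nsq 0 = 0 := by simp [nsq]
  have hmdot0 : ∀ A, mdot2 A 0 = 0 := fun A ↦ by simp [mdot2]
  have hdet0 : det2 0 = 0 := by simp [det2]
  have hcn : Continuous nsq := by unfold nsq; fun_prop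
  have hcd : Continuous det2 := by unfold det2; fun_prop
  have hcm : ∀ A, Continuous (mdot2 A) := fun A ↦ by unfold mdot2; fun_prop
  have hcD : Continuous fun η ↦ mdot2 (Dg k (ξ + η)) η := by
    simp only [mdot2, Dg, nsq, det2, cof2, Fin.sum_univ_two, Pi.add_apply, Matrix.cons_val_zero,
      Matrix.cons_val_one]
    fun_prop
  rw [hset (fun η ↦ nsq η ^ 2) (by simp [hnsq0]),
    hset (fun η ↦ mdot2 (Dg k (ξ + η)) η) (hmdot0 _)]
  have hi1 := (hint (fun η ↦ nsq η ^ 2) (hcn.pow 2) (by simp [hnsq0])).const_mul ((8 - k) / 8)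
  have hi2 := hint (mdot2 (Dg k ξ)) (hcm _) (hmdot0 _)
  have hi3 := (hint det2 hcd hdet0).const_mul (2 * k * det2 ξ)
  have hi23 : Integrable fun x ↦
      mdot2 (Dg k ξ) (jac2 φ x) + 2 * k * det2 ξ * det2 (jac2 φ x) := hi2.add hi3
  calc (8 - k) / 8 * ∫ x, nsq (jac2 φ x) ^ 2
      = ∫ x, ((8 - k) / 8 * nsq (jac2 φ x) ^ 2 +
          (mdot2 (Dg k ξ) (jac2 φ x) + 2 * k * det2 ξ * det2 (jac2 φ x))) := by
        rw [integral_add hi1 hi23, integral_add hi2 hi3, integral_const_mul,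
          integral_const_mul, hlin, hdet]
        ring
    _ ≤ ∫ x, mdot2 (Dg k (ξ + jac2 φ x)) (jac2 φ x) :=
        integral_mono (hi1.add hi23)
          (hint (fun η ↦ mdot2 (Dg k (ξ + η)) η) hcD (hmdot0 _))
          fun x ↦ le_mdot2_Dg_add hk0 hk8 ξ (jac2 φ x)
end

section
/- Failure of integral convexity of g_k for k outside [−2, 4]: let Ω ⊂ ℝ² be a nonempty bounded open set and let k ∈ ℝ with k > 4 or k < −2. Then there exist ψ, φ ∈ C_c^∞(Ω;ℝ²) such that ∫_Ω B_k(Dψ(x), Dφ(x)) dx < 0, where B_k(ξ,η) := 8(ξ:η)² + 4|ξ|²|η|² + 2k (η : cof ξ)² + 4k (det ξ)(det η) is the second variation D²g_k(ξ)(η,η) of g_k(ξ) = |ξ|⁴ + k (det ξ)². Consequently g_k is not integral convex for such k. -/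
open MeasureTheory

/-- The second variation of `g_k(ξ) = |ξ|⁴ + k (det ξ)²`:
`B_k(ξ,η) = D²g_k(ξ)(η,η) = 8(ξ:η)² + 4|ξ|²|η|² + 2k(η:cof ξ)² + 4k(det ξ)(det η)`. -/
def Bq (k : ℝ) (ξ η : Fin 2 → Fin 2 → ℝ) : ℝ :=
  8 * mdot2 ξ η ^ 2 + 4 * nsq ξ * nsq η + 2 * k * mdot2 η (cof2 ξ) ^ 2 +
    4 * k * det2 ξ * det2 η

open scoped Topology

/-- Every point of an open set carries a bump `χ` together with a cutoff `η` that equals `1` near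
the support of `χ`. -/
lemma exists_bump_and_cutoff {E : Type*} [NormedAddCommGroup E] [NormedSpace ℝ E]
    [FiniteDimensional ℝ E] {Ω : Set E} (hΩ : IsOpen Ω) {p : E} (hp : p ∈ Ω) :
    ∃ χ η : E → ℝ,
      (ContDiff ℝ (⊤ : ℕ∞) χ ∧ HasCompactSupport χ ∧ tsupport χ ⊆ Ω) ∧
      (ContDiff ℝ (⊤ : ℕ∞) η ∧ HasCompactSupport η ∧ tsupport η ⊆ Ω) ∧
      χ p ≠ 0 ∧ ∀ x ∈ tsupport χ, η =ᶠ[𝓝 x] fun _ => 1 := by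
  obtain ⟨r, hr, hrΩ⟩ := Metric.nhds_basis_closedBall.mem_iff.1 (hΩ.mem_nhds hp)
  let f : ContDiffBump p := ⟨r / 4, r / 3, by positivity, by linarith⟩
  let g : ContDiffBump p := ⟨r / 2, r, by positivity, by linarith⟩
  refine ⟨f, g, ⟨f.contDiff, f.hasCompactSupport, ?_⟩, ⟨g.contDiff, g.hasCompactSupport, ?_⟩,
    ?_, fun x hx => g.eventuallyEq_one_of_mem_ball ?_⟩
  · rw [f.tsupport_eq]
    exact (Metric.closedBall_subset_closedBall (show r / 3 ≤ r by linarith)).trans hrΩ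
  · rw [g.tsupport_eq]
    exact hrΩ
  · rw [f.one_of_mem_closedBall (Metric.mem_closedBall_self f.rIn_pos.le)]
    exact one_ne_zero
  · rw [f.tsupport_eq] at hx
    exact Metric.closedBall_subset_ball (show r / 3 < r / 2 by linarith) hx

lemma jac2_eq_of_hasFDerivAt {φ : (Fin 2 → ℝ) → Fin 2 → ℝ} {x : Fin 2 → ℝ}
    {L : Fin 2 → (Fin 2 → ℝ) →L[ℝ] ℝ} (h : ∀ i, HasFDerivAt (fun y => φ y i) (L i) x) :
    jac2 φ x = fun i j => L i (Pi.single j 1) := by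
  ext i j
  simp [jac2, (hasFDerivAt_pi.2 h).fderiv]

lemma jac2_congr {φ ψ : (Fin 2 → ℝ) → Fin 2 → ℝ} {x : Fin 2 → ℝ} (h : φ =ᶠ[𝓝 x] ψ) :
    jac2 φ x = jac2 ψ x := by
  unfold jac2
  rw [h.fderiv_eq]

lemma jac2_smul_eq_zero {χ : (Fin 2 → ℝ) → ℝ} (φ : (Fin 2 → ℝ) → Fin 2 → ℝ) {x : Fin 2 → ℝ}
    (hx : x ∉ tsupport χ) : jac2 (fun y => χ y • φ y) x = 0 := by
  have h : (fun y => χ y • φ y) =ᶠ[𝓝 x] fun _ => 0 := by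
    filter_upwards [notMem_tsupport_iff_eventuallyEq.1 hx] with y hy
    simp [hy]
  rw [jac2_congr h]
  ext i j
  simp [jac2]

lemma Bq_zero_right (k : ℝ) (ξ : Fin 2 → Fin 2 → ℝ) : Bq k ξ 0 = 0 := by
  simp [Bq, mdot2, nsq, det2]

lemma contDiff_smul_and_support {χ : (Fin 2 → ℝ) → ℝ} {φ : (Fin 2 → ℝ) → Fin 2 → ℝ}
    {Ω : Set (Fin 2 → ℝ)}
    (hχ : ContDiff ℝ (⊤ : ℕ∞) χ ∧ HasCompactSupport χ ∧ tsupport χ ⊆ Ω)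
    (hφ : ContDiff ℝ (⊤ : ℕ∞) φ) :
    ContDiff ℝ (⊤ : ℕ∞) (fun x => χ x • φ x) ∧ HasCompactSupport (fun x => χ x • φ x) ∧
      tsupport (fun x => χ x • φ x) ⊆ Ω :=
  ⟨hχ.1.smul hφ, hχ.2.1.smul_right, (tsupport_smul_subset_left χ φ).trans hχ.2.2⟩

/-- Cutting off `ψ` away from the support of `χ` does not affect the second variation at `ψ` in
direction `χ φ`, so `ψ` need not have compact support. -/
lemma exists_test_maps_of_integral_neg {Ω : Set (Fin 2 → ℝ)} {k : ℝ} {χ η : (Fin 2 → ℝ) → ℝ}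
    (hχ : ContDiff ℝ (⊤ : ℕ∞) χ ∧ HasCompactSupport χ ∧ tsupport χ ⊆ Ω)
    (hη : ContDiff ℝ (⊤ : ℕ∞) η ∧ HasCompactSupport η ∧ tsupport η ⊆ Ω)
    (hηχ : ∀ x ∈ tsupport χ, η =ᶠ[𝓝 x] fun _ => 1)
    {ψ φ : (Fin 2 → ℝ) → Fin 2 → ℝ}
    (hψ : ContDiff ℝ (⊤ : ℕ∞) ψ) (hφ : ContDiff ℝ (⊤ : ℕ∞) φ)
    (hneg : ∫ x, Bq k (jac2 ψ x) (jac2 (fun y => χ y • φ y) x) < 0) :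
    ∃ ψ φ : (Fin 2 → ℝ) → Fin 2 → ℝ,
      (ContDiff ℝ (⊤ : ℕ∞) ψ ∧ HasCompactSupport ψ ∧ tsupport ψ ⊆ Ω) ∧
      (ContDiff ℝ (⊤ : ℕ∞) φ ∧ HasCompactSupport φ ∧ tsupport φ ⊆ Ω) ∧
      ∫ x in Ω, Bq k (jac2 ψ x) (jac2 φ x) < 0 := by
  refine ⟨_, _, contDiff_smul_and_support hη hψ, contDiff_smul_and_support hχ hφ, ?_⟩
  rw [setIntegral_eq_integral_of_forall_compl_eq_zero]
  · convert hneg using 3 with x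
    by_cases hx : x ∈ tsupport χ
    · congr 1
      apply jac2_congr
      filter_upwards [hηχ x hx] with y hy
      simp [hy]
    · rw [jac2_smul_eq_zero φ hx, Bq_zero_right, Bq_zero_right]
  · intro x hx
    rw [jac2_smul_eq_zero φ fun h => hx (hχ.2.2 h), Bq_zero_right]

section Partial

variable {χ : (Fin 2 → ℝ) → ℝ}

/-- The partial derivative `∂ⱼχ`. -/
noncomputable def partialD (χ : (Fin 2 → ℝ) → ℝ) (j : Fin 2) (x : Fin 2 → ℝ) : ℝ :=
  fderiv ℝ χ x (Pi.single j 1)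

lemma continuous_partialD (hχ : ContDiff ℝ (⊤ : ℕ∞) χ) (j : Fin 2) :
    Continuous (partialD χ j) :=
  (hχ.continuous_fderiv (by simp)).clm_apply continuous_const

lemma HasCompactSupport.partialD (hχ : HasCompactSupport χ) (j : Fin 2) :
    HasCompactSupport (partialD χ j) :=
  hχ.fderiv_apply (𝕜 := ℝ) _

lemma integrable_partialD_mul (hχ : ContDiff ℝ (⊤ : ℕ∞) χ) (hc : HasCompactSupport χ)
    (j : Fin 2) {f : (Fin 2 → ℝ) → ℝ} (hf : Continuous f) :
    Integrable (fun x => partialD χ j x * f x) :=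
  ((continuous_partialD hχ j).mul hf).integrable_of_hasCompactSupport (hc.partialD j).mul_right

end Partial

lemma integrable_mul_of_hasCompactSupport {χ f : (Fin 2 → ℝ) → ℝ} (hχ : Continuous χ)
    (hc : HasCompactSupport χ) (hf : Continuous f) : Integrable (fun x => χ x * f x) :=
  (hχ.mul hf).integrable_of_hasCompactSupport hc.mul_right

/-- The map `e^{-n z}` on `ℂ = ℝ²`. -/
noncomputable def expHol (n : ℝ) (x : Fin 2 → ℝ) : Fin 2 → ℝ :=
  ![Real.exp (-(n * x 0)) * Real.cos (n * x 1), -(Real.exp (-(n * x 0)) * Real.sin (n * x 1))]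

/-- The map `e^{n z̄}` on `ℂ = ℝ²`. -/
noncomputable def expAntihol (n : ℝ) (x : Fin 2 → ℝ) : Fin 2 → ℝ :=
  ![Real.exp (n * x 0) * Real.cos (n * x 1), -(Real.exp (n * x 0) * Real.sin (n * x 1))]

lemma contDiff_expHol (n : ℝ) : ContDiff ℝ (⊤ : ℕ∞) (expHol n) := by
  refine contDiff_pi.2 fun i => ?_
  fin_cases i <;> simp only [expHol] <;> simp <;> fun_prop

lemma contDiff_expAntihol (n : ℝ) : ContDiff ℝ (⊤ : ℕ∞) (expAntihol n) := by
  refine contDiff_pi.2 fun i => ?_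
  fin_cases i <;> simp only [expAntihol] <;> simp <;> fun_prop

lemma hasFDerivAt_const_mul_coord (n : ℝ) (i : Fin 2) (x : Fin 2 → ℝ) :
    HasFDerivAt (fun y : Fin 2 → ℝ => n * y i)
      (n • (ContinuousLinearMap.proj i : (Fin 2 → ℝ) →L[ℝ] ℝ)) x :=
  (hasFDerivAt_apply i x).const_mul n

lemma jac2_expHol (n : ℝ) (x : Fin 2 → ℝ) :
    jac2 (expHol n) x =
      ![![-n * Real.exp (-(n * x 0)) * Real.cos (n * x 1),
          -n * Real.exp (-(n * x 0)) * Real.sin (n * x 1)],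
        ![n * Real.exp (-(n * x 0)) * Real.sin (n * x 1),
          -n * Real.exp (-(n * x 0)) * Real.cos (n * x 1)]] := by
  have hE := (hasFDerivAt_const_mul_coord n 0 x).fun_neg.exp
  have hC := (hasFDerivAt_const_mul_coord n 1 x).cos
  have hS := (hasFDerivAt_const_mul_coord n 1 x).sin
  rw [jac2_eq_of_hasFDerivAt (φ := expHol n) (L := ![_, _])
    (Fin.forall_fin_two.2 ⟨hE.mul hC, (hE.mul hS).neg⟩)]
  ext i j
  fin_cases i <;> fin_cases j <;> simp <;> ring

lemma jac2_smul_expAntihol {χ : (Fin 2 → ℝ) → ℝ} {x : Fin 2 → ℝ} (hχ : DifferentiableAt ℝ χ x)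
    (n : ℝ) :
    jac2 (fun y => χ y • expAntihol n y) x =
      ![![Real.exp (n * x 0) * ((partialD χ 0 x + n * χ x) * Real.cos (n * x 1)),
          Real.exp (n * x 0) *
            (partialD χ 1 x * Real.cos (n * x 1) - n * χ x * Real.sin (n * x 1))],
        ![-(Real.exp (n * x 0) * ((partialD χ 0 x + n * χ x) * Real.sin (n * x 1))),
          -(Real.exp (n * x 0) *
            (partialD χ 1 x * Real.sin (n * x 1) + n * χ x * Real.cos (n * x 1)))]] := by
  have hE := (hasFDerivAt_const_mul_coord n 0 x).exp
  have hC := (hasFDerivAt_const_mul_coord n 1 x).cos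
  have hS := (hasFDerivAt_const_mul_coord n 1 x).sin
  rw [jac2_eq_of_hasFDerivAt (φ := fun y => χ y • expAntihol n y) (L := ![_, _])
    (Fin.forall_fin_two.2 ⟨hχ.hasFDerivAt.mul (hE.mul hC), hχ.hasFDerivAt.mul (hE.mul hS).neg⟩)]
  ext i j
  fin_cases i <;> fin_cases j <;> simp [partialD, expAntihol] <;> ring

lemma Bq_expHol_expAntihol {χ : (Fin 2 → ℝ) → ℝ} {x : Fin 2 → ℝ} (hχ : DifferentiableAt ℝ χ x)
    (k n : ℝ) :
    Bq k (jac2 (expHol n) x) (jac2 (fun y => χ y • expAntihol n y) x) =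
      n ^ 2 * ((16 + 2 * k) * partialD χ 0 x ^ 2 + 8 * partialD χ 1 x ^ 2 -
        (4 * k - 16) * (n * χ x * partialD χ 0 x + n ^ 2 * χ x ^ 2)) := by
  rw [jac2_expHol, jac2_smul_expAntihol hχ]
  set u := partialD χ 0 x
  set v := partialD χ 1 x
  have hEF : Real.exp (-(n * x 0)) * Real.exp (n * x 0) = 1 := by rw [← Real.exp_add]; simp
  have hCS := Real.sin_sq_add_cos_sq (n * x 1)
  set E := Real.exp (-(n * x 0))
  set F := Real.exp (n * x 0)
  set C := Real.cos (n * x 1)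
  set S := Real.sin (n * x 1)
  set ξ : Fin 2 → Fin 2 → ℝ := ![![-n * E * C, -n * E * S], ![n * E * S, -n * E * C]] with hξ
  set η : Fin 2 → Fin 2 → ℝ := ![![F * ((u + n * χ x) * C), F * (v * C - n * χ x * S)],
    ![-(F * ((u + n * χ x) * S)), -(F * (v * S + n * χ x * C))]] with hη
  have h1 : mdot2 ξ η = -n * (E * F) * (u * (S ^ 2 + C ^ 2)) := by
    simp [mdot2, hξ, hη]; ring
  have h2 : mdot2 η (cof2 ξ) = -n * (E * F) * (u * (S ^ 2 + C ^ 2)) := by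
    simp [mdot2, cof2, hξ, hη]; ring
  have h3 : nsq ξ = 2 * n ^ 2 * E ^ 2 * (S ^ 2 + C ^ 2) := by
    simp [nsq, hξ]; ring
  have h4 : nsq η = F ^ 2 * (((u + n * χ x) ^ 2 + v ^ 2 + n ^ 2 * χ x ^ 2) * (S ^ 2 + C ^ 2)) := by
    simp [nsq, hη]; ring
  have h5 : det2 ξ = n ^ 2 * E ^ 2 * (S ^ 2 + C ^ 2) := by
    simp [det2, hξ]; ring
  have h6 : det2 η = -(F ^ 2 * ((u + n * χ x) * (n * χ x) * (S ^ 2 + C ^ 2))) := by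
    simp [det2, hη]; ring
  rw [Bq, h1, h2, h3, h4, h5, h6, hCS, hEF]
  have hEF2 : E ^ 2 * F ^ 2 = 1 := by rw [← mul_pow, hEF, one_pow]
  linear_combination (8 * n ^ 2 * ((u + n * χ x) ^ 2 + v ^ 2 + n ^ 2 * χ x ^ 2) -
    4 * k * n ^ 2 * ((u + n * χ x) * (n * χ x))) * hEF2

/-- The second coordinate as a map into the second component. -/
def shearBase (x : Fin 2 → ℝ) : Fin 2 → ℝ := ![0, x 1]

lemma contDiff_shearBase : ContDiff ℝ (⊤ : ℕ∞) shearBase := by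
  refine contDiff_pi.2 fun i => ?_
  fin_cases i <;> simp only [shearBase] <;> simp <;> fun_prop

lemma jac2_shearBase (x : Fin 2 → ℝ) : jac2 shearBase x = ![![0, 0], ![0, 1]] := by
  rw [jac2_eq_of_hasFDerivAt (φ := shearBase) (L := ![_, _])
    (Fin.forall_fin_two.2 ⟨hasFDerivAt_const (0 : ℝ) x, hasFDerivAt_apply 1 x⟩)]
  ext i j
  fin_cases i <;> fin_cases j <;> simp

lemma Bq_shearBase {χ f : (Fin 2 → ℝ) → ℝ} {x : Fin 2 → ℝ} (hχ : DifferentiableAt ℝ χ x)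
    {f' : (Fin 2 → ℝ) →L[ℝ] ℝ} (hf : HasFDerivAt f f' x) (k : ℝ) :
    Bq k (jac2 shearBase x) (jac2 (fun y => χ y • ![f y, 0]) x) =
      (4 + 2 * k) * (χ x * f' (Pi.single 0 1) + f x * partialD χ 0 x) ^ 2 +
        4 * (χ x * f' (Pi.single 1 1) + f x * partialD χ 1 x) ^ 2 := by
  rw [jac2_shearBase, jac2_eq_of_hasFDerivAt (φ := fun y => χ y • ![f y, 0]) (L := ![_, _])
    (Fin.forall_fin_two.2 ⟨hχ.hasFDerivAt.mul hf, hχ.hasFDerivAt.mul (hasFDerivAt_const 0 x)⟩)]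
  simp [Bq, mdot2, nsq, det2, cof2, partialD]
  ring

lemma exists_integral_sub_sq_mul_neg {α : Type*} [MeasurableSpace α] {μ : Measure α}
    {F G : α → ℝ} (hF : Integrable F μ) (hG : Integrable G μ) (hpos : 0 < ∫ x, G x ∂μ) :
    ∃ n : ℝ, 0 < n ∧ ∫ x, (F x - n ^ 2 * G x) ∂μ < 0 := by
  have hlim : Filter.Tendsto (fun n : ℝ => n ^ 2 * ∫ x, G x ∂μ) Filter.atTop Filter.atTop :=
    (Filter.tendsto_pow_atTop two_ne_zero).atTop_mul_const hpos
  obtain ⟨n, hn, hn0⟩ :=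
    ((hlim.eventually_gt_atTop (∫ x, F x ∂μ)).and (Filter.eventually_gt_atTop 0)).exists
  refine ⟨n, hn0, ?_⟩
  rw [integral_sub hF (hG.const_mul _), integral_const_mul]
  linarith

section Cases

variable {χ : (Fin 2 → ℝ) → ℝ}

lemma integrable_partialD_sq (hχ : ContDiff ℝ (⊤ : ℕ∞) χ) (hc : HasCompactSupport χ)
    (j : Fin 2) : Integrable (fun x => partialD χ j x ^ 2) := by
  simpa only [sq] using integrable_partialD_mul hχ hc j (continuous_partialD hχ j)

lemma integrable_sq_of_hasCompactSupport (hχ : Continuous χ) (hc : HasCompactSupport χ) :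
    Integrable (fun x => χ x ^ 2) := by
  simpa only [sq] using integrable_mul_of_hasCompactSupport hχ hc hχ

lemma integral_sq_pos (hχ : Continuous χ) (hc : HasCompactSupport χ) {p : Fin 2 → ℝ}
    (hp : χ p ≠ 0) : 0 < ∫ x, χ x ^ 2 := by
  refine (hχ.pow 2).integral_pos_of_hasCompactSupport_nonneg_nonzero (x := p) ?_
    (fun x => sq_nonneg _) (pow_ne_zero 2 hp)
  exact hc.comp_left (g := fun t : ℝ => t ^ 2) (by simp)

lemma exists_expHol_integral_neg (hχ : ContDiff ℝ (⊤ : ℕ∞) χ) (hc : HasCompactSupport χ)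
    {p : Fin 2 → ℝ} (hp : χ p ≠ 0) {k : ℝ} (hk : 4 < k) :
    ∃ n : ℝ, ∫ x, Bq k (jac2 (expHol n) x) (jac2 (fun y => χ y • expAntihol n y) x) < 0 := by
  have hd (x) : DifferentiableAt ℝ χ x := hχ.differentiable (by simp) x
  have hu := integrable_partialD_sq hχ hc 0
  have hv := integrable_partialD_sq hχ hc 1
  have hs := integrable_sq_of_hasCompactSupport hχ.continuous hc
  have hF : Integrable fun x =>
      (8 + 4 * k) * partialD χ 0 x ^ 2 + 8 * partialD χ 1 x ^ 2 :=
    (hu.const_mul _).add (hv.const_mul _)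
  have hG : Integrable fun x => (2 * k - 8) * χ x ^ 2 := hs.const_mul _
  obtain ⟨n, hn, hneg⟩ := exists_integral_sub_sq_mul_neg hF hG (by
    rw [integral_const_mul]
    exact mul_pos (by linarith) (integral_sq_pos hχ.continuous hc hp))
  refine ⟨n, ?_⟩
  simp_rw [Bq_expHol_expAntihol (hd _), integral_const_mul]
  refine mul_neg_of_pos_of_neg (by positivity) (lt_of_le_of_lt (integral_mono ?_ ?_ ?_) hneg)
  · have hχu := integrable_partialD_mul hχ hc 0 (hχ.continuous.const_mul n)
    refine ((hu.const_mul _).add (hv.const_mul _)).sub (Integrable.const_mul (.add ?_ ?_) _)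
    · simpa only [mul_comm] using hχu
    · exact hs.const_mul _
  · exact hF.sub (hG.const_mul _)
  · intro x
    nlinarith [mul_nonneg (sub_pos.2 hk).le (sq_nonneg (n * χ x + partialD χ 0 x))]

lemma exists_shearBase_integral_neg (hχ : ContDiff ℝ (⊤ : ℕ∞) χ) (hc : HasCompactSupport χ)
    {p : Fin 2 → ℝ} (hp : χ p ≠ 0) {k : ℝ} (hk : k < -2) :
    ∃ f : (Fin 2 → ℝ) → ℝ, ContDiff ℝ (⊤ : ℕ∞) f ∧
      ∫ x, Bq k (jac2 shearBase x) (jac2 (fun y => χ y • ![f y, 0]) x) < 0 := by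
  have hd (x) : DifferentiableAt ℝ χ x := hχ.differentiable (by simp) x
  have hu := integrable_partialD_sq hχ hc 0
  have hv := integrable_partialD_sq hχ hc 1
  have hs := integrable_sq_of_hasCompactSupport hχ.continuous hc
  have hF : Integrable fun x =>
      (4 + 2 * k) * partialD χ 0 x ^ 2 + 4 * partialD χ 1 x ^ 2 :=
    (hu.const_mul _).add (hv.const_mul _)
  have hG : Integrable fun x => -(4 + 2 * k) * χ x ^ 2 := hs.const_mul _
  obtain ⟨n, -, hneg⟩ := exists_integral_sub_sq_mul_neg hF hG (by
    rw [integral_const_mul]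
    exact mul_pos (by linarith) (integral_sq_pos hχ.continuous hc hp))
  have hcont := hχ.continuous
  have hu0 := continuous_partialD hχ 0
  have hv0 := continuous_partialD hχ 1
  have hint {f : (Fin 2 → ℝ) → ℝ} (hf : ContDiff ℝ (⊤ : ℕ∞) f) :
      Integrable fun x => Bq k (jac2 shearBase x) (jac2 (fun y => χ y • ![f y, 0]) x) := by
    refine Continuous.integrable_of_hasCompactSupport ?_ ?_
    · have hf' (x) : HasFDerivAt f (fderiv ℝ f x) x :=
        (hf.differentiable (by simp) x).hasFDerivAt
      simp_rw [Bq_shearBase (hd _) (hf' _)]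
      have hf0 : Continuous fun x => fderiv ℝ f x (Pi.single 0 1) := continuous_partialD hf 0
      have hf1 : Continuous fun x => fderiv ℝ f x (Pi.single 1 1) := continuous_partialD hf 1
      have hf_cont := hf.continuous
      fun_prop
    · refine HasCompactSupport.intro hc fun x hx => ?_
      rw [jac2_smul_eq_zero _ hx, Bq_zero_right]
  have hcos : ContDiff ℝ (⊤ : ℕ∞) fun x : Fin 2 → ℝ => Real.cos (n * x 0) := by fun_prop
  have hsin : ContDiff ℝ (⊤ : ℕ∞) fun x : Fin 2 → ℝ => Real.sin (n * x 0) := by fun_prop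
  by_contra! hcon
  refine hneg.not_ge ((add_nonneg (hcon _ hcos) (hcon _ hsin)).trans_eq ?_)
  rw [← integral_add (hint hcos) (hint hsin)]
  congr 1
  ext x
  rw [Bq_shearBase (hd x) (hasFDerivAt_const_mul_coord n 0 x).cos,
    Bq_shearBase (hd x) (hasFDerivAt_const_mul_coord n 0 x).sin]
  simp
  linear_combination ((4 + 2 * k) * (partialD χ 0 x ^ 2 + n ^ 2 * χ x ^ 2) +
    4 * partialD χ 1 x ^ 2) * Real.sin_sq_add_cos_sq (n * x 0)

end Cases

/-- Failure of integral convexity of `g_k` for `k > 4` or `k < −2`: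
there exist test maps `ψ, φ ∈ C_c^∞(Ω;ℝ²)` making the second variation integral
`∫_Ω D²g_k(Dψ)(Dφ,Dφ) dx` negative. -/
theorem gk_not_integral_convex_of_k_outside_Icc
    (Ω : Set (Fin 2 → ℝ)) (hΩo : IsOpen Ω) (hΩne : Ω.Nonempty)
    (hΩb : Bornology.IsBounded Ω)
    (k : ℝ) (hk : 4 < k ∨ k < -2) :
    ∃ ψ φ : (Fin 2 → ℝ) → Fin 2 → ℝ,
      (ContDiff ℝ (⊤ : ℕ∞) ψ ∧ HasCompactSupport ψ ∧ tsupport ψ ⊆ Ω) ∧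
      (ContDiff ℝ (⊤ : ℕ∞) φ ∧ HasCompactSupport φ ∧ tsupport φ ⊆ Ω) ∧
      ∫ x in Ω, Bq k (jac2 ψ x) (jac2 φ x) < 0 := by
  obtain ⟨p, hp⟩ := hΩne
  obtain ⟨χ, η, hχ, hη, hχp, hηχ⟩ := exists_bump_and_cutoff hΩo hp
  rcases hk with hk | hk
  · obtain ⟨n, hn⟩ := exists_expHol_integral_neg hχ.1 hχ.2.1 hχp hk
    exact exists_test_maps_of_integral_neg hχ hη hηχ (contDiff_expHol n) (contDiff_expAntihol n) hn
  · obtain ⟨f, hf, hneg⟩ := exists_shearBase_integral_neg hχ.1 hχ.2.1 hχp hk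
    refine exists_test_maps_of_integral_neg hχ hη hηχ contDiff_shearBase
      (contDiff_pi.2 fun i => ?_) hneg
    fin_cases i
    · exact hf
    · exact contDiff_const
end
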